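/- Let G be a finite simple graph with m := |E(G)| ≥ 7·10^10 edges and maximum degree Δ. Then tes(G) = max{⌈(m+2)/3⌉, ⌈(Δ+1)/2⌉}. -/

import Mathlib

open SimpleGraph

/-- `IsEdgeIrregularTotalWeighting G s wv we` : the combined weighting given by `wv` on
vertices and `we` on edges is an edge irregular total `s`-weighting of `G`, i.e. all weights
lie in `{1, …, s}` and distinct edges receive distinct total weights
`we(uv) + wv(u) + wv(v)`. -/
def IsEdgeIrregularTotalWeighting {V : Type*} (G : SimpleGraph V) (s : ℕ)
    (wv : V → ℕ) (we : Sym2 V → ℕ) : Prop :=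
  (∀ v, 1 ≤ wv v ∧ wv v ≤ s) ∧
  (∀ e ∈ G.edgeSet, 1 ≤ we e ∧ we e ≤ s) ∧
  ∀ u v u' v', G.Adj u v → G.Adj u' v' → s(u, v) ≠ s(u', v') →
    we s(u, v) + wv u + wv v ≠ we s(u', v') + wv u' + wv v'

/-- The total edge irregularity strength of `G` : the least `s` admitting an edge irregular
total `s`-weighting. -/
noncomputable def tes {V : Type*} (G : SimpleGraph V) : ℕ :=
  sInf {s : ℕ | ∃ (wv : V → ℕ) (we : Sym2 V → ℕ), IsEdgeIrregularTotalWeighting G s wv we}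

namespace TES

variable {V : Type*} [Fintype V] [DecidableEq V]

/-- number of edges from `v` into `S` -/
def jn (E : Finset (V × V)) (S : Finset V) (v : V) : ℕ :=
  (E.filter (fun e => (e.1 = v ∧ e.2 ∈ S) ∨ (e.2 = v ∧ e.1 ∈ S))).card

/-- number of edges inside `S` -/
def ins (E : Finset (V × V)) (S : Finset V) : ℕ :=
  (E.filter (fun e => e.1 ∈ S ∧ e.2 ∈ S)).card

lemma sum_jn (E : Finset (V × V)) (S Z : Finset V) (h : Disjoint S Z) :
    ∑ v ∈ Z, jn E S v =
      (E.filter (fun e => (e.1 ∈ Z ∧ e.2 ∈ S) ∨ (e.2 ∈ Z ∧ e.1 ∈ S))).card := by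
  unfold jn
  rw [← Finset.card_biUnion]
  · congr 1
    ext e
    simp only [Finset.mem_biUnion, Finset.mem_filter]
    constructor
    · rintro ⟨v, hv, he, h1 | h1⟩
      · exact ⟨he, Or.inl ⟨h1.1 ▸ hv, h1.2⟩⟩
      · exact ⟨he, Or.inr ⟨h1.1 ▸ hv, h1.2⟩⟩
    · rintro ⟨he, h1 | h1⟩
      · exact ⟨e.1, h1.1, he, Or.inl ⟨rfl, h1.2⟩⟩
      · exact ⟨e.2, h1.1, he, Or.inr ⟨rfl, h1.2⟩⟩
  · intro u hu v hv huv
    rw [Function.onFun, Finset.disjoint_left]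
    intro e he he'
    simp only [Finset.mem_filter] at he he'
    have hd := Finset.disjoint_left.1 h
    rcases he.2 with h1 | h1 <;> rcases he'.2 with h2 | h2
    · exact huv (h1.1.symm.trans h2.1)
    · exact hd h1.2 (h2.1 ▸ hv)
    · exact hd h1.2 (h2.1 ▸ hv)
    · exact huv (h1.1.symm.trans h2.1)

lemma oneside (E : Finset (V × V)) (k : ℕ) (w : V → ℕ) (X Z Y : Finset V)
    (hp : ∀ v, v ∈ X ∨ v ∈ Z ∨ v ∈ Y) (hXZ : Disjoint X Z)
    (r : V → ℕ) (hr : Set.InjOn r Z)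
    (hX : ∀ v ∈ X, w v = 0) (hY : ∀ v ∈ Y, k ≤ w v)
    (hZ1 : ∀ v ∈ Z, w v ≤ ins E X + ∑ u ∈ Z with r u < r v, jn E X u)
    (hZ2 : ∀ v ∈ Z, min (ins E X + ∑ u ∈ Z with r u < r v, jn E X u) (k / 2) ≤ w v)
    (h1 : k ≤ ins E X + ∑ v ∈ Z, jn E X v)
    (u1 : ins E X + ∑ v ∈ Z, jn E X v + ins E Z ≤ k + 1 + k / 2)
    (u2 : ins E X ≤ k + 1) (u3 : ∀ v ∈ Z, jn E X v + ins E Z ≤ k + 1)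
    (x : ℕ) (hx : x < k) :
    x + 1 ≤ (E.filter (fun e => w e.1 + w e.2 ≤ x)).card ∧
    (E.filter (fun e => w e.1 + w e.2 ≤ x)).card ≤ x + k + 1 := by
  have hsub : ∀ Z' ⊆ Z, Disjoint X Z' := fun Z' h => Finset.disjoint_of_subset_right h hXZ
  have low : ∀ Z' ⊆ Z, (∀ v ∈ Z', w v ≤ x) →
      ins E X + ∑ v ∈ Z', jn E X v ≤ (E.filter (fun e => w e.1 + w e.2 ≤ x)).card := by
    intro Z' hZ' hw
    rw [sum_jn E X Z' (hsub Z' hZ'), ins, ← Finset.card_union_of_disjoint]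
    · apply Finset.card_le_card
      intro e he
      simp only [Finset.mem_union, Finset.mem_filter] at he ⊢
      rcases he with ⟨he, h1, h2⟩ | ⟨he, ⟨h1, h2⟩ | ⟨h1, h2⟩⟩
      · refine ⟨he, ?_⟩; rw [hX _ h1, hX _ h2]; omega
      · refine ⟨he, ?_⟩; rw [hX _ h2]; have := hw _ h1; omega
      · refine ⟨he, ?_⟩; rw [hX _ h2]; have := hw _ h1; omega
    · rw [Finset.disjoint_left]
      intro e he he'
      simp only [Finset.mem_filter] at he he'
      have hd := Finset.disjoint_left.1 (hsub Z' hZ')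
      rcases he'.2 with h2 | h2
      · exact hd he.2.1 h2.1
      · exact hd he.2.2 h2.1
  have up : ∀ Z' ⊆ Z, (∀ v ∈ Z, w v ≤ x → v ∈ Z') → 
      (E.filter (fun e => w e.1 + w e.2 ≤ x)).card ≤
        ins E X + ∑ v ∈ Z', jn E X v + ins E Z' := by
    intro Z' hZ' hw
    rw [sum_jn E X Z' (hsub Z' hZ'), ins, ins]
    refine le_trans (Finset.card_le_card (t := (E.filter (fun e => e.1 ∈ X ∧ e.2 ∈ X) ∪ 
      E.filter (fun e => (e.1 ∈ Z' ∧ e.2 ∈ X) ∨ (e.2 ∈ Z' ∧ e.1 ∈ X))) ∪ 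
      E.filter (fun e => e.1 ∈ Z' ∧ e.2 ∈ Z')) ?_) ?_
    · intro e he
      simp only [Finset.mem_union, Finset.mem_filter] at he ⊢
      obtain ⟨he, hle⟩ := he
      have key : ∀ v, w v ≤ x → v ∈ X ∨ v ∈ Z' := by
        intro v hv
        rcases hp v with h | h | h
        · exact Or.inl h
        · exact Or.inr (hw v h hv)
        · have := hY v h; omega
      rcases key e.1 (by omega) with a | a <;> rcases key e.2 (by omega) with b | b <;> tauto
    · refine (Finset.card_union_le _ _).trans ?_
      have := Finset.card_union_le (E.filter (fun e => e.1 ∈ X ∧ e.2 ∈ X))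
        (E.filter (fun e => (e.1 ∈ Z' ∧ e.2 ∈ X) ∨ (e.2 ∈ Z' ∧ e.1 ∈ X)))
      omega
  constructor
  · by_cases hall : ∀ v ∈ Z, w v ≤ x
    · have := low Z (Finset.Subset.refl _) hall
      omega
    · push Not at hall
      obtain ⟨v0, hv0, hv0x⟩ := hall
      obtain ⟨v, hv, hmin⟩ := Finset.exists_min_image (Z.filter (fun v => x < w v)) r
        ⟨v0, by simp [hv0, hv0x]⟩
      simp only [Finset.mem_filter] at hv hmin
      have := low (Z.filter (fun u => r u < r v)) (Finset.filter_subset _ _) (by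
        intro u hu
        simp only [Finset.mem_filter] at hu
        by_contra hc
        have := hmin u ⟨hu.1, by omega⟩
        omega)
      have := hZ1 v hv.1
      omega
  · by_cases hx2 : k / 2 ≤ x
    · have := up Z (Finset.Subset.refl _) (fun v hv _ => hv)
      omega
    · by_cases hem : (Z.filter (fun v => w v ≤ x)) = ∅
      · have h0 := up ∅ (Finset.empty_subset _) (by
          intro v hv hvx
          rw [← hem]; simp [hv, hvx])
        have : ins E (∅ : Finset V) = 0 := by simp [ins]
        simp only [Finset.sum_empty] at h0
        omega
      · obtain ⟨v, hv, hmax⟩ := Finset.exists_max_image (Z.filter (fun v => w v ≤ x)) r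
          (Finset.nonempty_iff_ne_empty.2 hem)
        simp only [Finset.mem_filter] at hv hmax
        have h0 := up (insert v (Z.filter (fun u => r u < r v))) (by
            intro u hu
            simp only [Finset.mem_insert, Finset.mem_filter] at hu
            rcases hu with rfl | hu
            · exact hv.1
            · exact hu.1) (by
            intro u hu hux
            simp only [Finset.mem_insert, Finset.mem_filter]
            rcases (hmax u ⟨hu, hux⟩).lt_or_eq with h | h
            · exact Or.inr ⟨hu, h⟩
            · exact Or.inl (hr hu hv.1 h))
        rw [Finset.sum_insert (by simp)] at h0
        have h2 : ins E (insert v (Z.filter (fun u => r u < r v))) ≤ ins E Z := by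
          apply Finset.card_le_card
          intro e he
          have : ∀ u, u ∈ insert v (Z.filter (fun u => r u < r v)) → u ∈ Z := by
            intro u hu
            simp only [Finset.mem_insert, Finset.mem_filter] at hu
            rcases hu with rfl | hu
            · exact hv.1
            · exact hu.1
          simp only [Finset.mem_filter] at he ⊢
          exact ⟨he.1, this _ he.2.1, this _ he.2.2⟩
        have h3 := hZ2 v hv.1
        have h4 := u3 v hv.1
        have h5 := hv.2
        omega

/-- the required balance property of a vertex weighting -/
def Good (E : Finset (V × V)) (k : ℕ) (w : V → ℕ) : Prop :=
  (∀ v, w v ≤ k) ∧ ∀ x < k,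
    (x + 1 ≤ (E.filter (fun e => w e.1 + w e.2 ≤ x)).card ∧
    (E.filter (fun e => w e.1 + w e.2 ≤ x)).card ≤ x + k + 1) ∧
    (x + 1 ≤ (E.filter (fun e => (k - w e.1) + (k - w e.2) ≤ x)).card ∧
    (E.filter (fun e => (k - w e.1) + (k - w e.2) ≤ x)).card ≤ x + k + 1)

lemma exact_good (E : Finset (V × V)) (k : ℕ) (X Z Y : Finset V)
    (hp : ∀ v, v ∈ X ∨ v ∈ Z ∨ v ∈ Y) (hXZ : Disjoint X Z) (hXY : Disjoint X Y)
    (hYZ : Disjoint Y Z)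
    (r : V → ℕ) (hr : Set.InjOn r Z)
    (h1 : k ≤ ins E X + ∑ v ∈ Z, jn E X v)
    (h1' : k ≤ ins E Y + ∑ v ∈ Z, jn E Y v)
    (h2 : ∀ v ∈ Z, k ≤ (ins E X + ∑ u ∈ Z with r u < r v, jn E X u) +
      (ins E Y + ∑ u ∈ Z with r v < r u, jn E Y u))
    (u1 : ins E X + ∑ v ∈ Z, jn E X v + ins E Z ≤ k + 1 + k / 2)
    (u1' : ins E Y + ∑ v ∈ Z, jn E Y v + ins E Z ≤ k + 1 + k / 2)
    (u2 : ins E X ≤ k + 1) (u2' : ins E Y ≤ k + 1)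
    (u3 : ∀ v ∈ Z, jn E X v + ins E Z ≤ k + 1)
    (u3' : ∀ v ∈ Z, jn E Y v + ins E Z ≤ k + 1) :
    ∃ w, Good E k w := by
  classical
  set hi : V → ℕ := fun v => ins E X + ∑ u ∈ Z with r u < r v, jn E X u with hhi
  set lo : V → ℕ := fun v => ins E Y + ∑ u ∈ Z with r v < r u, jn E Y u with hlo
  let w : V → ℕ := fun v => if v ∈ X then 0 else if v ∈ Z then
    max (k - lo v) (min (hi v) (k / 2)) else k
  have wX : ∀ v ∈ X, w v = 0 := fun v hv => by simp [w, hv]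
  have wZ : ∀ v ∈ Z, w v = max (k - lo v) (min (hi v) (k / 2)) := fun v hv => by
    have : v ∉ X := fun h => Finset.disjoint_left.1 hXZ h hv
    simp [w, hv, this]
  have wY : ∀ v ∈ Y, w v = k := fun v hv => by
    have h1 : v ∉ X := fun h => Finset.disjoint_left.1 hXY h hv
    have h2 : v ∉ Z := fun h => Finset.disjoint_left.1 hYZ hv h
    simp [w, h1, h2]
  refine ⟨w, ?_, ?_⟩
  · intro v
    rcases hp v with h | h | h
    · rw [wX v h]; omega
    · rw [wZ v h]; omega
    · rw [wY v h]
  · intro x hx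
    refine ⟨oneside E k w X Z Y hp hXZ r hr wX (fun v hv => (wY v hv).ge) ?_ ?_ h1 u1 u2 u3 x hx,
      ?_⟩
    · intro v hv
      have := h2 v hv
      rw [wZ v hv]
      change k ≤ hi v + lo v at this
      change _ ≤ hi v
      omega
    · intro v hv
      rw [wZ v hv]
      change min (hi v) _ ≤ _
      omega
    · obtain ⟨R, hR⟩ : ∃ R, ∀ v ∈ Z, r v ≤ R := ⟨Z.sup r, fun v hv => Finset.le_sup hv⟩
      have hrr : ∀ v ∈ Z, (Z.filter (fun u => R - r u < R - r v)) =
          Z.filter (fun u => r v < r u) := by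
        intro v hv
        apply Finset.filter_congr
        intro u hu
        have := hR v hv
        have := hR u hu
        omega
      refine oneside E k (fun v => k - w v) Y Z X (fun v => by have := hp v; tauto) hYZ
        (fun v => R - r v) ?_ ?_ ?_ ?_ ?_ h1' u1' u2' u3' x hx
      · intro u hu v hv huv
        have := hR v hv
        have := hR u hu
        simp only at huv
        exact hr hu hv (by omega)
      · intro v hv; simp [wY v hv]
      · intro v hv; simp [wX v hv]
      · intro v hv
        rw [hrr v hv, wZ v hv]
        change _ ≤ lo v
        omega
      · intro v hv
        rw [hrr v hv, wZ v hv]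
        change min (lo v) _ ≤ _
        omega

end TES

namespace TES
set_option linter.unusedSectionVars false

variable {V : Type*} [Fintype V] [DecidableEq V]

/-- number of edges avoiding `X` and meeting `S` -/
def tch (E : Finset (V × V)) (X S : Finset V) : ℕ :=
  (E.filter (fun e => (e.1 ∉ X ∧ e.2 ∉ X) ∧ (e.1 ∈ S ∨ e.2 ∈ S))).card

lemma tch_add (E : Finset (V × V)) (X S : Finset V) :
    tch E X S + ins E (X ∪ S)ᶜ = ins E Xᶜ := by
  unfold tch ins
  rw [← Finset.card_union_of_disjoint]
  · congr 1
    ext e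
    simp only [Finset.mem_union, Finset.mem_filter, Finset.mem_compl]
    tauto
  · rw [Finset.disjoint_left]
    intro e he he'
    simp only [Finset.mem_union, Finset.mem_filter, Finset.mem_compl] at he he'
    tauto

lemma split3 (E : Finset (V × V)) (X Z : Finset V) (h : Disjoint X Z) :
    ins E (X ∪ Z)ᶜ + ∑ v ∈ Z, jn E (X ∪ Z)ᶜ v + ins E Z = ins E Xᶜ := by
  have hd : Disjoint (X ∪ Z)ᶜ Z := by
    rw [Finset.disjoint_left]; intro a ha hb
    simp only [Finset.mem_union, Finset.mem_compl] at ha; tauto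
  rw [sum_jn _ _ _ hd]
  have hd := Finset.disjoint_right.1 h
  unfold ins
  rw [← Finset.card_union_of_disjoint, ← Finset.card_union_of_disjoint]
  · congr 1
    ext e
    have h1 := @hd e.1
    have h2 := @hd e.2
    simp only [Finset.mem_union, Finset.mem_filter, Finset.mem_compl]
    tauto
  all_goals
    rw [Finset.disjoint_left]
    intro e he he'
    simp only [Finset.mem_union, Finset.mem_filter, Finset.mem_compl] at he he'
    tauto

lemma jn_mono (E : Finset (V × V)) {S T : Finset V} (h : S ⊆ T) (v : V) : jn E S v ≤ jn E T v := by
  apply Finset.card_le_card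
  intro e he
  simp only [Finset.mem_filter] at he ⊢
  have h1 := @h e.1
  have h2 := @h e.2
  tauto

lemma jn_compl_le (E : Finset (V × V)) (X Z : Finset V) (v : V) :
    jn E (X ∪ Z)ᶜ v ≤ jn E Xᶜ v := by
  apply jn_mono
  intro a; simp only [Finset.mem_union, Finset.mem_compl]; tauto

lemma ins_le_aux (E : Finset (V × V)) (hloop : ∀ e ∈ E, e.1 ≠ e.2) (X S : Finset V) (o : V) :
    ins E (X ∪ S)ᶜ ≤ ins E (X ∪ insert o S)ᶜ + jn E (X ∪ insert o S)ᶜ o := by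
  unfold ins jn
  rw [← Finset.card_union_of_disjoint]
  · apply Finset.card_le_card
    intro e' he'
    simp only [Finset.mem_filter, Finset.mem_insert, Finset.mem_union, Finset.mem_compl,
      not_or] at he' ⊢
    have hl := hloop e' he'.1
    by_cases h5 : e'.1 = o
    · have h6 : e'.2 ≠ o := fun h => hl (h5.trans h.symm)
      exact Or.inr ⟨he'.1, Or.inl ⟨h5, he'.2.2.1, h6, he'.2.2.2⟩⟩
    · by_cases h6 : e'.2 = o
      · exact Or.inr ⟨he'.1, Or.inr ⟨h6, he'.2.1.1, h5, he'.2.1.2⟩⟩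
      · exact Or.inl ⟨he'.1, ⟨he'.2.1.1, h5, he'.2.1.2⟩, ⟨he'.2.2.1, h6, he'.2.2.2⟩⟩
  · rw [Finset.disjoint_left]
    intro e he he'
    simp only [Finset.mem_insert, Finset.mem_union, Finset.mem_filter, Finset.mem_compl,
      not_or] at he he'
    rcases he'.2 with h | h
    · exact he.2.1.2.1 h.1
    · exact he.2.2.2.1 h.1

set_option maxHeartbeats 1000000 in
lemma case1 (E : Finset (V × V)) (hloop : ∀ e ∈ E, e.1 ≠ e.2) (k δ : ℕ) (X P : Finset V)
    (hPX : Disjoint X P) (hM : ins E Xᶜ = k + δ) (hδ : δ ≤ k / 2) (α : ℕ) (hα : α ≤ 2)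
    (ha : ∀ v ∈ P, jn E X v ≤ α) (hαδ : 2 * α * δ ≤ k) (hA : ins E X ≤ 1) (hk : 10 ≤ k)
    (hP : ∀ v ∈ P, jn E Xᶜ v ≤ k / 2) (hnP : ins E (X ∪ P)ᶜ ≤ k)
    (S0 : Finset V) (hS0P : S0 ⊆ P) (hS0 : k ≤ ins E X + ∑ v ∈ S0, jn E X v)
    (ht : tch E X S0 + 2 ≤ δ) : ∃ w, Good E k w := by
  classical
  obtain ⟨S, hS, hmax⟩ := Finset.exists_max_image
    (P.powerset.filter (fun S => k ≤ ins E X + ∑ v ∈ S, jn E X v ∧ tch E X S + 2 ≤ δ))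
    (fun S => tch E X S * (Fintype.card V + 1) + (Fintype.card V - S.card))
    ⟨S0, by simp [hS0P, hS0, ht]⟩
  simp only [Finset.mem_filter, Finset.mem_powerset] at hS hmax
  obtain ⟨hSP, hSa, hSt⟩ := hS
  have hXS : Disjoint X S := Finset.disjoint_of_subset_right hSP hPX
  -- untouched vertex
  have hz : ∃ z ∈ S, 1 ≤ jn E X z ∧ ∀ e ∈ E, e.1 ∉ X → e.2 ∉ X → e.1 ≠ z ∧ e.2 ≠ z := by
    by_contra hc
    push Not at hc
    set F := E.filter (fun e => (e.1 ∉ X ∧ e.2 ∉ X) ∧ (e.1 ∈ S ∨ e.2 ∈ S)) with hF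
    have hsub : S.filter (fun z => 1 ≤ jn E X z) ⊆ F.image Prod.fst ∪ F.image Prod.snd := by
      intro z hz
      simp only [Finset.mem_filter] at hz
      obtain ⟨e, he, h1, h2, h3⟩ := hc z hz.1 hz.2
      simp only [Finset.mem_union, Finset.mem_image]
      by_cases h4 : e.1 = z
      · left
        exact ⟨e, by simp only [hF, Finset.mem_filter]; exact ⟨he, ⟨h1, h2⟩, Or.inl (h4 ▸ hz.1)⟩, h4⟩
      · right
        exact ⟨e, by simp only [hF, Finset.mem_filter]; exact ⟨he, ⟨h1, h2⟩, Or.inr (h3 h4 ▸ hz.1)⟩, h3 h4⟩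
    have hc1 : (S.filter (fun z => 1 ≤ jn E X z)).card ≤ tch E X S + tch E X S := by
      refine (Finset.card_le_card hsub).trans ((Finset.card_union_le _ _).trans ?_)
      exact Nat.add_le_add Finset.card_image_le Finset.card_image_le
    have hs1 : ∑ v ∈ S, jn E X v = ∑ v ∈ S with 1 ≤ jn E X v, jn E X v := by
      rw [Finset.sum_filter]
      apply Finset.sum_congr rfl
      intro v _
      split_ifs with h
      · rfl
      · omega
    have hs2 : ∑ v ∈ S with 1 ≤ jn E X v, jn E X v ≤
        (S.filter (fun z => 1 ≤ jn E X z)).card * α := by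
      rw [← smul_eq_mul]
      apply Finset.sum_le_card_nsmul
      intro v hv
      exact ha v (hSP (Finset.mem_filter.1 hv).1)
    interval_cases α <;> omega
  obtain ⟨z, hzS, hz1, hz2⟩ := hz
  have hSle : ins E X + ∑ v ∈ S, jn E X v ≤ k + 1 := by
    by_contra hc
    have hza := ha z (hSP hzS)
    have hsum := Finset.sum_erase_add S (fun v => jn E X v) hzS
    have hte : tch E X (S.erase z) = tch E X S := by
      unfold tch
      congr 1
      apply Finset.filter_congr
      intro e he
      have := hz2 e he
      simp only [Finset.mem_erase]
      tauto
    have := hmax (S.erase z) ⟨(Finset.erase_subset _ _).trans hSP, by omega, by omega⟩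
    rw [hte, Finset.card_erase_of_mem hzS] at this
    have h1 : S.card ≤ Fintype.card V := Finset.card_le_univ S
    have h2 : 0 < S.card := Finset.card_pos.2 ⟨z, hzS⟩
    omega
  -- the vertex o
  have hadd := tch_add E X S
  obtain ⟨e, he, he1, he2⟩ : ∃ e ∈ E, (e.1 ∉ X ∧ e.2 ∉ X ∧ e.1 ∉ S ∧ e.2 ∉ S) ∧
      (e.1 ∈ P ∨ e.2 ∈ P) := by
    by_contra hc
    push Not at hc
    have : ins E (X ∪ S)ᶜ ≤ ins E (X ∪ P)ᶜ := by
      apply Finset.card_le_card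
      intro e he
      simp only [Finset.mem_filter, Finset.mem_compl, Finset.mem_union] at he ⊢
      have := hc e he.1
      tauto
    omega
  obtain ⟨o, hoP, hoX, hoS, hoe⟩ : ∃ o ∈ P, o ∉ X ∧ o ∉ S ∧ (e.1 = o ∨ e.2 = o) := by
    rcases he2 with h | h
    · exact ⟨e.1, h, he1.1, he1.2.2.1, Or.inl rfl⟩
    · exact ⟨e.2, h, he1.2.1, he1.2.2.2, Or.inr rfl⟩
  have htlt : tch E X S + 1 ≤ tch E X (insert o S) := by
    apply Finset.card_lt_card
    rw [Finset.ssubset_iff_of_subset]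
    · refine ⟨e, ?_, ?_⟩
      · simp only [Finset.mem_filter, Finset.mem_insert]
        tauto
      · simp only [Finset.mem_filter]
        tauto
    · intro e' he'
      simp only [Finset.mem_filter, Finset.mem_insert] at he' ⊢
      tauto
  have hto : δ ≤ tch E X (insert o S) + 1 := by
    by_contra hc
    have := hmax (insert o S) ⟨Finset.insert_subset hoP hSP, by
      rw [Finset.sum_insert hoS]; omega, by omega⟩
    have h3 : (tch E X S + 1) * (Fintype.card V + 1) ≤
      tch E X (insert o S) * (Fintype.card V + 1) := Nat.mul_le_mul_right _ htlt
    rw [Nat.add_mul] at h3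
    omega
  have hXZ : Disjoint X (insert o S) := by
    rw [Finset.disjoint_insert_right]; exact ⟨hoX, hXS⟩
  have h3 := split3 E X (insert o S) hXZ
  have h4 := tch_add E X (insert o S)
  have hins : ins E (insert o S) ≤ tch E X S := by
    apply Finset.card_le_card
    intro e' he'
    have hl := hloop e' 
    have hd := Finset.disjoint_right.1 hXZ
    have hd1 := @hd e'.1
    have hd2 := @hd e'.2
    simp only [Finset.mem_filter, Finset.mem_insert] at he' hd1 hd2 ⊢
    refine ⟨he'.1, ⟨hd1 he'.2.1, hd2 he'.2.2⟩, ?_⟩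
    rcases he'.2 with ⟨h5 | h5, h6 | h6⟩
    · exact absurd (h5.trans h6.symm) (hl he'.1)
    · exact Or.inr h6
    · exact Or.inl h5
    · exact Or.inl h5
  have hB := ins_le_aux E hloop X S o
  have hap := ha o hoP
  set r : V → ℕ := fun v => if v = o then Fintype.card V else (Fintype.equivFin V v : ℕ) with hrdef
  have hrlt : ∀ v, v ≠ o → r v < Fintype.card V := by
    intro v hv; simp [hrdef, hv]
  have hro : r o = Fintype.card V := by simp [hrdef]
  refine exact_good E k X (insert o S) (X ∪ insert o S)ᶜ ?_ hXZ ?_ ?_ r ?_ ?_ ?_ ?_ ?_ ?_ ?_ ?_ ?_ ?_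
  · intro v; simp only [Finset.mem_compl, Finset.mem_union]; tauto
  · rw [Finset.disjoint_left]; intro a; simp only [Finset.mem_compl, Finset.mem_union]; tauto
  · rw [Finset.disjoint_left]; intro a; simp only [Finset.mem_compl, Finset.mem_union]; tauto
  · intro u _ v _ huv
    by_cases hu : u = o
    · by_cases hv : v = o
      · rw [hu, hv]
      · have := hrlt v hv
        rw [hu, hro] at huv; omega
    · by_cases hv : v = o
      · have := hrlt u hu
        rw [hv, hro] at huv; omega
      · simp only [hrdef, hu, hv, if_false] at huv
        exact (Fintype.equivFin V).injective (Fin.ext huv)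
  · rw [Finset.sum_insert hoS]; omega
  · omega
  · intro v hv
    by_cases hvo : v = o
    · have : (insert o S).filter (fun u => r u < r v) = S := by
        ext u
        simp only [Finset.mem_filter, Finset.mem_insert]
        constructor
        · rintro ⟨h | h, h'⟩
          · rw [h, hvo] at h'; omega
          · exact h
        · intro h
          have : u ≠ o := fun h' => hoS (h' ▸ h)
          refine ⟨Or.inr h, ?_⟩
          rw [hvo, hro]; exact hrlt u this
      rw [this]; omega
    · have : jn E (X ∪ insert o S)ᶜ o ≤
          ∑ u ∈ insert o S with r v < r u, jn E (X ∪ insert o S)ᶜ u := by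
        apply Finset.single_le_sum (f := fun u => jn E (X ∪ insert o S)ᶜ u) (fun _ _ => Nat.zero_le _)
        simp only [Finset.mem_filter, Finset.mem_insert, true_or, true_and]
        rw [hro]; exact hrlt v hvo
      omega
  · rw [Finset.sum_insert hoS]; omega
  · omega
  · omega
  · omega
  · intro v hv
    have : v ∈ P := by
      rcases Finset.mem_insert.1 hv with h | h
      · exact h ▸ hoP
      · exact hSP h
    have := ha v this
    omega
  · intro v hv
    have : v ∈ P := by
      rcases Finset.mem_insert.1 hv with h | h
      · exact h ▸ hoP
      · exact hSP h
    have := hP v this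
    have := jn_compl_le E X (insert o S) v
    omega

end TES

namespace TES
set_option linter.unusedSectionVars false

variable {V : Type*} [Fintype V] [DecidableEq V]

lemma ins_erase (E : Finset (V × V)) (hloop : ∀ e ∈ E, e.1 ≠ e.2) (N : Finset V) (v : V)
    (hv : v ∈ N) : ins E (N.erase v) + jn E N v = ins E N := by
  unfold ins jn
  rw [← Finset.card_union_of_disjoint]
  · congr 1
    ext e
    simp only [Finset.mem_union, Finset.mem_filter, Finset.mem_erase]
    constructor
    · rintro (⟨h1, h2, h3⟩ | ⟨h1, ⟨h2, h3⟩ | ⟨h2, h3⟩⟩)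
      · exact ⟨h1, h2.2, h3.2⟩
      · exact ⟨h1, h2 ▸ hv, h3⟩
      · exact ⟨h1, h3, h2 ▸ hv⟩
    · rintro ⟨h1, h2, h3⟩
      by_cases h4 : e.1 = v
      · exact Or.inr ⟨h1, Or.inl ⟨h4, h3⟩⟩
      · by_cases h5 : e.2 = v
        · exact Or.inr ⟨h1, Or.inr ⟨h5, h2⟩⟩
        · exact Or.inl ⟨h1, ⟨h4, h2⟩, ⟨h5, h3⟩⟩
  · rw [Finset.disjoint_left]
    intro e he he'
    simp only [Finset.mem_filter, Finset.mem_erase] at he he'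
    rcases he'.2 with h | h
    · exact he.2.1.1 h.1
    · exact he.2.2.1 h.1

lemma ins_mono (E : Finset (V × V)) {S T : Finset V} (h : S ⊆ T) : ins E S ≤ ins E T := by
  apply Finset.card_le_card
  intro e he
  simp only [Finset.mem_filter] at he ⊢
  exact ⟨he.1, h he.2.1, h he.2.2⟩

lemma sum_jn_self (E : Finset (V × V)) (hloop : ∀ e ∈ E, e.1 ≠ e.2) (N : Finset V) :
    ∑ v ∈ N, jn E N v = 2 * ins E N := by
  have h1 : ∀ v ∈ N, jn E N v =
      ((E.filter (fun e => e.1 ∈ N ∧ e.2 ∈ N)).filter (fun e => e.1 = v)).card +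
      ((E.filter (fun e => e.1 ∈ N ∧ e.2 ∈ N)).filter (fun e => e.2 = v)).card := by
    intro v hv
    unfold jn
    rw [← Finset.card_union_of_disjoint]
    · congr 1
      ext e
      simp only [Finset.mem_union, Finset.mem_filter]
      constructor
      · rintro ⟨h1, ⟨h2, h3⟩ | ⟨h2, h3⟩⟩
        · exact Or.inl ⟨⟨h1, h2 ▸ hv, h3⟩, h2⟩
        · exact Or.inr ⟨⟨h1, h3, h2 ▸ hv⟩, h2⟩
      · rintro (⟨⟨h1, h2, h3⟩, h4⟩ | ⟨⟨h1, h2, h3⟩, h4⟩)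
        · exact ⟨h1, Or.inl ⟨h4, h3⟩⟩
        · exact ⟨h1, Or.inr ⟨h4, h2⟩⟩
    · rw [Finset.disjoint_left]
      intro e he he'
      simp only [Finset.mem_filter] at he he'
      exact hloop e he.1.1 (he.2.trans he'.2.symm)
  rw [Finset.sum_congr rfl h1, Finset.sum_add_distrib,
    ← Finset.card_eq_sum_card_fiberwise, ← Finset.card_eq_sum_card_fiberwise, ins]
  · ring
  · intro e he
    simp only [Finset.coe_filter, Set.mem_ofPred_eq] at he
    exact he.2.2
  · intro e he
    simp only [Finset.coe_filter, Set.mem_ofPred_eq] at he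
    exact he.2.1

lemma peel1 (E : Finset (V × V)) (hloop : ∀ e ∈ E, e.1 ≠ e.2) (k n : ℕ) :
    ∀ N : Finset V, N.card = k + n → ∃ Z ⊆ N, Z.card = k ∧
      (ins E Z = 0 ∨ ins E Z + n ≤ ins E N) := by
  induction n with
  | zero => intro N hN; exact ⟨N, Finset.Subset.refl _, hN, Or.inr le_rfl⟩
  | succ n ih =>
    intro N hN
    by_cases h0 : ins E N = 0
    · obtain ⟨Z, hZ, hc⟩ := Finset.exists_subset_card_eq (s := N) (n := k) (by omega)
      exact ⟨Z, hZ, hc, Or.inl (by have := ins_mono E hZ; omega)⟩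
    · obtain ⟨e, he⟩ := Finset.card_pos.1 (Nat.pos_of_ne_zero h0)
      simp only [Finset.mem_filter] at he
      have hpos : 1 ≤ jn E N e.1 := Finset.card_pos.2 ⟨e,
        Finset.mem_filter.2 ⟨he.1, Or.inl ⟨rfl, he.2.2⟩⟩⟩
      have h1 := ins_erase E hloop N e.1 he.2.1
      obtain ⟨Z, hZ, hc, h⟩ := ih (N.erase e.1) (by rw [Finset.card_erase_of_mem he.2.1]; omega)
      exact ⟨Z, hZ.trans (Finset.erase_subset _ _), hc, by omega⟩

lemma peel (E : Finset (V × V)) (hloop : ∀ e ∈ E, e.1 ≠ e.2) (k n : ℕ) :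
    ∀ N : Finset V, N.card = k + n → ∃ Z ⊆ N, Z.card = k ∧
      (ins E Z = 0 ∨ ins E Z + 2 * n ≤ ins E N ∨ 3 * ins E Z + 2 * n ≤ ins E N + k) := by
  induction n with
  | zero => intro N hN; exact ⟨N, Finset.Subset.refl _, hN, Or.inr (Or.inl le_rfl)⟩
  | succ n ih =>
    intro N hN
    by_cases h2 : ∃ v ∈ N, 2 ≤ jn E N v
    · obtain ⟨v, hv, h2⟩ := h2
      have h1 := ins_erase E hloop N v hv
      obtain ⟨Z, hZ, hc, h⟩ := ih (N.erase v) (by rw [Finset.card_erase_of_mem hv]; omega)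
      exact ⟨Z, hZ.trans (Finset.erase_subset _ _), hc, by omega⟩
    · push Not at h2
      obtain ⟨Z, hZ, hc, h⟩ := peel1 E hloop k (n + 1) N hN
      have h3 := sum_jn_self E hloop N
      have h4 : ∑ v ∈ N, jn E N v ≤ N.card • 1 :=
        Finset.sum_le_card_nsmul _ _ _ (fun v hv => by have := h2 v hv; omega)
      rw [smul_eq_mul] at h4
      exact ⟨Z, hZ, hc, by omega⟩

lemma jn_singleton_le (E : Finset (V × V)) (hs : ∀ e ∈ E, (e.2, e.1) ∉ E) (h v : V) :
    jn E {h} v ≤ 1 := by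
  unfold jn
  rw [Finset.card_le_one]
  intro a ha b hb
  simp only [Finset.mem_filter, Finset.mem_singleton] at ha hb
  obtain ⟨a1, a2⟩ := a
  obtain ⟨b1, b2⟩ := b
  have := hs _ ha.1
  simp only at *
  rcases ha.2 with ⟨h1, h2⟩ | ⟨h1, h2⟩ <;> rcases hb.2 with ⟨h3, h4⟩ | ⟨h3, h4⟩ <;> subst h1 h2 h3 <;> simp_all

lemma ins_le_sq (E : Finset (V × V)) (S : Finset V) : ins E S ≤ S.card * S.card := by
  rw [← Finset.card_product]
  apply Finset.card_le_card
  intro e he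
  simp only [Finset.mem_filter] at he
  simp [he.2.1, he.2.2]

lemma ins_univ (E : Finset (V × V)) : ins E Finset.univ = E.card := by
  unfold ins; simp

lemma regimeS (E : Finset (V × V)) (hloop : ∀ e ∈ E, e.1 ≠ e.2) (hs : ∀ e ∈ E, (e.2, e.1) ∉ E)
    (k : ℕ) (hk : 1000 ≤ k) (hE : E.card = 3 * k + 1) (h : V)
    (hd1 : 3 * k + 6 ≤ 2 * jn E Finset.univ h) (hd2 : jn E Finset.univ h ≤ 2 * k + 1) :
    ∃ w, Good E k w := by
  classical
  obtain ⟨δ, hδ⟩ : ∃ δ, jn E Finset.univ h + δ = 2 * k + 1 := ⟨2 * k + 1 - jn E Finset.univ h, by omega⟩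
  have hcompl : Finset.univ.erase h = ({h} : Finset V)ᶜ := by
    ext v; simp
  have hM : ins E ({h} : Finset V)ᶜ = k + δ := by
    have := ins_erase E hloop Finset.univ h (Finset.mem_univ _)
    rw [hcompl, ins_univ] at this
    omega
  have hA : ins E ({h} : Finset V) = 0 := by
    unfold ins
    rw [Finset.card_eq_zero, Finset.filter_eq_empty_iff]
    rintro e he ⟨h1, h2⟩
    simp only [Finset.mem_singleton] at h1 h2
    exact hloop e he (h1.trans h2.symm)
  set X : Finset V := {h} with hX
  have haX : ∀ v, jn E X v ≤ 1 := jn_singleton_le E hs h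
  set N : Finset V := Xᶜ.filter (fun v => jn E X v = 1) with hN
  have hNc : N.card = jn E Finset.univ h := by
    have h1 : ∑ v ∈ Xᶜ, jn E X v = jn E Finset.univ h := by
      rw [sum_jn _ _ _ disjoint_compl_right]
      unfold jn
      congr 1
      ext e
      simp only [Finset.mem_filter, hX, Finset.mem_compl, Finset.mem_singleton, Finset.mem_univ, and_true]
      have := hloop e
      constructor
      · tauto
      · rintro ⟨h1, h2 | h2⟩
        · exact ⟨h1, Or.inr ⟨fun h3 => this h1 (h2.trans h3.symm), h2⟩⟩
        · exact ⟨h1, Or.inl ⟨fun h3 => this h1 (h3.trans h2.symm), h2⟩⟩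
    rw [← h1, hN, Finset.card_filter]
    apply Finset.sum_congr rfl
    intro v _
    have := haX v
    split_ifs <;> omega
  set P : Finset V := Xᶜ.filter (fun v => jn E Xᶜ v ≤ k / 2) with hP
  set Q : Finset V := (X ∪ P)ᶜ with hQ
  have hQX : ∀ v ∈ Q, v ∉ X ∧ k / 2 < jn E Xᶜ v := by
    intro v hv
    simp only [hQ, hP, Finset.mem_compl, Finset.mem_union, Finset.mem_filter, not_or, not_and, not_le] at hv
    exact ⟨hv.1, hv.2 hv.1⟩
  have hQc : Q.card ≤ 5 := by
    have h1 := sum_jn_self E hloop Xᶜ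
    have h2 : ∑ v ∈ Q, jn E Xᶜ v ≤ ∑ v ∈ Xᶜ, jn E Xᶜ v :=
      Finset.sum_le_sum_of_subset (fun v hv => Finset.mem_compl.2 (hQX v hv).1)
    have h3 : Q.card • (k / 2 + 1) ≤ ∑ v ∈ Q, jn E Xᶜ v :=
      Finset.card_nsmul_le_sum _ _ _ (fun v hv => (hQX v hv).2)
    rw [smul_eq_mul] at h3
    by_contra hc
    have : 6 * (k / 2 + 1) ≤ Q.card * (k / 2 + 1) := Nat.mul_le_mul_right _ (by omega)
    omega
  have hnP : ins E (X ∪ P)ᶜ ≤ k := by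
    change ins E Q ≤ k
    have h1 := ins_le_sq E Q
    have h2 : Q.card * Q.card ≤ 5 * 5 := Nat.mul_le_mul hQc hQc
    omega
  have hXP : Disjoint X P := by
    rw [Finset.disjoint_left]; intro a ha hb
    simp only [hP, Finset.mem_filter, Finset.mem_compl] at hb
    exact hb.1 ha
  have hPm : ∀ v ∈ P, jn E Xᶜ v ≤ k / 2 := fun v hv => (Finset.mem_filter.1 hv).2
  by_cases hc1 : ∃ S ⊆ P, k ≤ ins E X + ∑ v ∈ S, jn E X v ∧ tch E X S + 2 ≤ δ
  · obtain ⟨S, hSP, h1, h2⟩ := hc1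
    exact case1 E hloop k δ X P hXP hM (by omega) 1 (by omega) (fun v _ => haX v) (by omega)
      (by omega) (by omega) hPm hnP S hSP h1 h2
  push Not at hc1
  -- choose an edge
  obtain ⟨e0, he0⟩ : ∃ e : V × V, e ∈ E.filter (fun e : V × V => e.1 ∈ Xᶜ ∧ e.2 ∈ Xᶜ) := by
    have : 0 < ins E Xᶜ := by omega
    exact Finset.card_pos.1 this
  simp only [Finset.mem_filter] at he0
  set D : Finset V := Q ∪ {e0.1, e0.2} with hD
  have hDc : D.card ≤ Q.card + 2 := (Finset.card_union_le _ _).trans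
    (Nat.add_le_add_left Finset.card_le_two _)
  set N0 : Finset V := N \ D with hN0
  have hN0c : N.card ≤ N0.card + D.card := by
    have := Finset.le_card_sdiff D N
    rw [← hN0] at this
    omega
  have hN0X : ∀ v ∈ N0, v ∉ X ∧ v ∉ D ∧ jn E X v = 1 := by
    intro v hv
    simp only [hN0, hN, Finset.mem_sdiff, Finset.mem_filter, Finset.mem_compl] at hv
    tauto
  have hN0ins : ins E N0 ≤ k + δ ∧ (Q.Nonempty → ins E N0 + k / 2 ≤ k + δ) := by
    constructor
    · rw [← hM]; exact ins_mono E (fun v hv => Finset.mem_compl.2 (hN0X v hv).1)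
    · rintro ⟨q, hq⟩
      have h1 := ins_erase E hloop Xᶜ q (Finset.mem_compl.2 (hQX q hq).1)
      have h2 := (hQX q hq).2
      have h3 : ins E N0 ≤ ins E (Xᶜ.erase q) := by
        apply ins_mono
        intro v hv
        rw [Finset.mem_erase]
        refine ⟨?_, Finset.mem_compl.2 (hN0X v hv).1⟩
        rintro rfl
        exact (hN0X v hv).2.1 (Finset.mem_union_left _ hq)
      omega
  obtain ⟨n, hn⟩ : ∃ n, N0.card = k + n := ⟨N0.card - k, by omega⟩
  obtain ⟨Z, hZ, hZc, hZi⟩ := peel E hloop k n N0 hn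
  have hZl : ins E Z ≤ δ := by
    rcases Finset.eq_empty_or_nonempty Q with hq | hq
    · rw [hq, Finset.card_empty] at hDc
      have := hN0ins.1
      omega
    · have := hN0ins.2 hq
      omega
  have hXZ : Disjoint X Z := by
    rw [Finset.disjoint_left]; intro a ha hb
    exact (hN0X a (hZ hb)).1 ha
  have hZa : ∀ v ∈ Z, jn E X v = 1 := fun v hv => (hN0X v (hZ hv)).2.2
  have hZsum : ∑ v ∈ Z, jn E X v = k := by
    rw [Finset.sum_congr rfl hZa]; simp [hZc]
  have hZP : Z ⊆ P := by
    intro v hv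
    have h1 := hN0X v (hZ hv)
    by_contra h2
    apply h1.2.1
    apply Finset.mem_union_left
    simp only [hQ, Finset.mem_compl, Finset.mem_union, not_or]
    exact ⟨h1.1, h2⟩
  have htch := hc1 Z hZP (by omega)
  have h3 := split3 E X Z hXZ
  have h4 := tch_add E X Z
  set Y := (X ∪ Z)ᶜ with hY
  have hB : 1 ≤ ins E Y := by
    apply Finset.card_pos.2
    refine ⟨e0, ?_⟩
    simp only [Finset.mem_filter, hY, Finset.mem_compl, Finset.mem_union, not_or]
    simp only [Finset.mem_compl] at he0
    have hz : ∀ v ∈ D, v ∉ Z := fun v hv hv' => (hN0X v (hZ hv')).2.1 hv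
    refine ⟨he0.1, ⟨he0.2.1, hz _ ?_⟩, ⟨he0.2.2, hz _ ?_⟩⟩ <;> simp [hD]
  obtain ⟨b, hb⟩ : ∃ b : V → ℕ, ∀ v, b v = jn E Y v := ⟨fun v => jn E Y v, fun _ => rfl⟩
  set r : V → ℕ := fun v => b v * Fintype.card V + (Fintype.equivFin V v : ℕ) with hrdef
  have hrb : ∀ u v, r u < r v → b u ≤ b v := by
    intro u v huv
    by_contra hc
    have h5 : (b v + 1) * Fintype.card V ≤ b u * Fintype.card V := Nat.mul_le_mul_right _ (by omega)
    rw [Nat.add_mul] at h5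
    have := (Fintype.equivFin V v).2
    simp only [hrdef] at huv
    omega
  have hrinj : Function.Injective r := by
    intro u v huv
    have h5 : r u % Fintype.card V = r v % Fintype.card V := by rw [huv]
    simp only [hrdef, Nat.mul_add_mod_self_right, Nat.mod_eq_of_lt (Fintype.equivFin V u).2,
      Nat.mod_eq_of_lt (Fintype.equivFin V v).2] at h5
    exact (Fintype.equivFin V).injective (Fin.ext h5)
  refine exact_good E k X Z Y ?_ hXZ ?_ ?_ r hrinj.injOn ?_ ?_ ?_ ?_ ?_ ?_ ?_ ?_ ?_
  · intro v; simp only [hY, Finset.mem_compl, Finset.mem_union]; tauto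
  · rw [Finset.disjoint_left]; intro a; simp only [hY, Finset.mem_compl, Finset.mem_union]; tauto
  · rw [Finset.disjoint_left]; intro a; simp only [hY, Finset.mem_compl, Finset.mem_union]; tauto
  · omega
  · omega
  · intro v hv
    have hsplit : ∀ f : V → ℕ, ∑ u ∈ Z, f u = (∑ u ∈ Z with r u < r v, f u) + f v +
        ∑ u ∈ Z with r v < r u, f u := by
      intro f
      rw [← Finset.sum_filter_add_sum_filter_not Z (fun u => r u < r v), add_assoc]
      congr 1
      have : Z.filter (fun u => ¬ r u < r v) = insert v (Z.filter (fun u => r v < r u)) := by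
        ext u
        simp only [Finset.mem_filter, Finset.mem_insert]
        constructor
        · rintro ⟨h1, h2⟩
          rcases (not_lt.1 h2).lt_or_eq with h3 | h3
          · exact Or.inr ⟨h1, h3⟩
          · exact Or.inl (hrinj h3).symm
        · rintro (rfl | ⟨h1, h2⟩)
          · exact ⟨hv, lt_irrefl _⟩
          · exact ⟨h1, by omega⟩
      rw [this, Finset.sum_insert (by simp)]
    have ha := hsplit (fun u => jn E X u)
    have hbb := hsplit (fun u => jn E Y u)
    have hav := hZa v hv
    by_cases hbv : b v = 0
    · have : ∑ u ∈ Z with r u < r v, jn E Y u = 0 := by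
        apply Finset.sum_eq_zero
        intro u hu
        have h5 := hrb u v (Finset.mem_filter.1 hu).2
        simp only [hb] at h5 hbv
        omega
      simp only [hb] at hbv
      omega
    · have : ∑ u ∈ Z with r v < r u, jn E X u ≤ ∑ u ∈ Z with r v < r u, jn E Y u := by
        apply Finset.sum_le_sum
        intro u hu
        have h5 := hrb v u (Finset.mem_filter.1 hu).2
        have h6 := hZa u (Finset.mem_filter.1 hu).1
        simp only [hb] at h5 hbv
        omega
      omega
  · omega
  · omega
  · omega
  · omega
  · intro v hv
    have := hZa v hv
    omega
  · intro v hv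
    have h5 := hPm v (hZP hv)
    have h6 := jn_compl_le E X Z v
    rw [← hY] at h6
    omega

end TES

namespace TES
set_option linter.unusedSectionVars false

variable {V : Type*} [Fintype V] [DecidableEq V]

lemma rank_exists (b : V → ℕ) : ∃ r : V → ℕ, Function.Injective r ∧ ∀ u v, r u < r v → b u ≤ b v := by
  refine ⟨fun v => b v * Fintype.card V + (Fintype.equivFin V v : ℕ), ?_, ?_⟩
  · intro u v huv
    have h5 : (b u * Fintype.card V + (Fintype.equivFin V u : ℕ)) % Fintype.card V =
      (b v * Fintype.card V + (Fintype.equivFin V v : ℕ)) % Fintype.card V := congrArg (· % _) huv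
    simp only [Nat.mul_add_mod_self_right, Nat.mod_eq_of_lt (Fintype.equivFin V u).2,
      Nat.mod_eq_of_lt (Fintype.equivFin V v).2] at h5
    exact (Fintype.equivFin V).injective (Fin.ext h5)
  · intro u v huv
    by_contra hc
    have h5 : (b v + 1) * Fintype.card V ≤ b u * Fintype.card V := Nat.mul_le_mul_right _ (by omega)
    rw [Nat.add_mul] at h5
    have := (Fintype.equivFin V v).2
    simp only at huv
    omega

lemma rank_split (r : V → ℕ) (hrinj : Function.Injective r) (Z : Finset V) (v : V) (hv : v ∈ Z)
    (f : V → ℕ) : ∑ u ∈ Z, f u = (∑ u ∈ Z with r u < r v, f u) + f v +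
        ∑ u ∈ Z with r v < r u, f u := by
  rw [← Finset.sum_filter_add_sum_filter_not Z (fun u => r u < r v), add_assoc]
  congr 1
  have : Z.filter (fun u => ¬ r u < r v) = insert v (Z.filter (fun u => r v < r u)) := by
    ext u
    simp only [Finset.mem_filter, Finset.mem_insert]
    constructor
    · rintro ⟨h1, h2⟩
      rcases (not_lt.1 h2).lt_or_eq with h3 | h3
      · exact Or.inr ⟨h1, h3⟩
      · exact Or.inl (hrinj h3).symm
    · rintro (rfl | ⟨h1, h2⟩)
      · exact ⟨hv, lt_irrefl _⟩
      · exact ⟨h1, by omega⟩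
  rw [this, Finset.sum_insert (by simp)]

lemma jn_union_le (E : Finset (V × V)) (S T : Finset V) (v : V) :
    jn E (S ∪ T) v ≤ jn E S v + jn E T v := by
  unfold jn
  refine le_trans (Finset.card_le_card ?_) (Finset.card_union_le _ _)
  intro e he
  simp only [Finset.mem_filter, Finset.mem_union] at he ⊢
  tauto

lemma jn_univ_split (E : Finset (V × V)) (hloop : ∀ e ∈ E, e.1 ≠ e.2) (S T : Finset V)
    (hST : Disjoint S T) (v : V) :
    jn E (S ∪ T) v = jn E S v + jn E T v := by
  unfold jn
  rw [← Finset.card_union_of_disjoint]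
  · congr 1
    ext e
    simp only [Finset.mem_filter, Finset.mem_union]
    tauto
  · rw [Finset.disjoint_left]
    intro e he he'
    simp only [Finset.mem_filter] at he he'
    have hd := Finset.disjoint_left.1 hST
    have := hloop e he.1
    rcases he.2 with h | h <;> rcases he'.2 with h' | h'
    · exact hd h.2 h'.2
    · exact this (h.1.trans h'.1.symm)
    · exact this (h'.1.trans h.1.symm)
    · exact hd h.2 h'.2

lemma jn_symm (E : Finset (V × V)) (u v : V) : jn E {u} v = jn E {v} u := by
  unfold jn
  congr 1
  ext e
  simp only [Finset.mem_filter, Finset.mem_singleton]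
  tauto

lemma jn_self_zero (E : Finset (V × V)) (hloop : ∀ e ∈ E, e.1 ≠ e.2) (v : V) : jn E {v} v = 0 := by
  unfold jn
  rw [Finset.card_eq_zero, Finset.filter_eq_empty_iff]
  rintro e he h
  simp only [Finset.mem_singleton] at h
  have := hloop e he
  rcases h with h | h
  · exact this (h.1.trans h.2.symm)
  · exact this (h.2.trans h.1.symm)

lemma ins_singleton (E : Finset (V × V)) (hloop : ∀ e ∈ E, e.1 ≠ e.2) (v : V) : ins E {v} = 0 := by
  unfold ins
  rw [Finset.card_eq_zero, Finset.filter_eq_empty_iff]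
  rintro e he ⟨h1, h2⟩
  simp only [Finset.mem_singleton] at h1 h2
  exact hloop e he (h1.trans h2.symm)

lemma exists_min_sub (a : V → ℕ) (Z0 : Finset V) (c : ℕ) (h : c ≤ ∑ v ∈ Z0, a v) :
    ∃ Z ⊆ Z0, c ≤ ∑ v ∈ Z, a v ∧ ∀ v ∈ Z, ∑ u ∈ Z, a u < c + a v := by
  induction Z0 using Finset.strongInduction with
  | H Z0 ih =>
    by_cases hc : ∃ v ∈ Z0, c + a v ≤ ∑ u ∈ Z0, a u
    · obtain ⟨v, hv, h1⟩ := hc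
      have h2 := Finset.add_sum_erase Z0 a hv
      obtain ⟨Z, hZ, h3⟩ := ih (Z0.erase v) (Finset.erase_ssubset hv) (by omega)
      exact ⟨Z, hZ.trans (Finset.erase_subset _ _), h3⟩
    · push Not at hc
      exact ⟨Z0, Finset.Subset.refl _, h, hc⟩

lemma regimeW0 (E : Finset (V × V)) (hloop : ∀ e ∈ E, e.1 ≠ e.2) (hs : ∀ e ∈ E, (e.2, e.1) ∉ E)
    (k : ℕ) (hk : 1000 ≤ k) (hE : E.card = 3 * k + 1) (a b c : V) (hab : a ≠ b) (hac : a ≠ c)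
    (hbc : b ≠ c)
    (ha : 22 * k ≤ 25 * jn E Finset.univ a) (hb : 22 * k ≤ 25 * jn E Finset.univ b)
    (hc : 22 * k ≤ 25 * jn E Finset.univ c)
    (hle : jn E Finset.univ a + jn E Finset.univ b ≤ 2 * k + 2 * jn E {a} b) :
    ∃ w, Good E k w := by
  classical
  have h1 := jn_singleton_le E hs
  set X : Finset V := {a, b} with hX
  have eab := h1 a b
  have eac := h1 a c
  have ebc := h1 b c
  have i1 := ins_erase E hloop Finset.univ a (Finset.mem_univ _)
  have i2 := ins_erase E hloop (Finset.univ.erase a) b (by simp [hab.symm])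
  have i3 := ins_erase E hloop ((Finset.univ.erase a).erase b) c (by simp [hac.symm, hbc.symm])
  have sp1 : jn E Finset.univ b = jn E (Finset.univ.erase a) b + jn E {a} b := by
    rw [← jn_univ_split E hloop _ _ (by simp)]; congr 1; ext; simp
  have sp2 : jn E Finset.univ c = jn E ((Finset.univ.erase a).erase b) c + jn E X c := by
    rw [← jn_univ_split E hloop _ _ (by simp [hX])]; congr 1; ext; simp [hX]; tauto
  have hX2 : ∀ v, jn E X v ≤ 2 := by
    intro v
    have : X = {a} ∪ {b} := by ext; simp [hX]
    rw [this]
    have := jn_union_le E {a} {b} v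
    have := h1 a v
    have := h1 b v
    omega
  have hXc : (Finset.univ.erase a).erase b = Xᶜ := by ext; simp [hX]; tauto
  have hA : ins E X = jn E {a} b := by
    have := ins_erase E hloop X b (by simp [hX])
    have h2 : X.erase b = {a} := by ext v; simp [hX]; constructor <;> grind
    rw [h2, ins_singleton E hloop] at this
    have h3 : X = {a} ∪ {b} := by ext; simp [hX]
    rw [← this, h3, jn_univ_split E hloop _ _ (by simpa using hab), jn_self_zero E hloop b]
    omega
  set P : Finset V := Xᶜ.erase c with hP
  rw [hXc] at i2 i3 sp2
  rw [← hP] at i3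
  rw [ins_univ] at i1
  obtain ⟨δ, hδ⟩ : ∃ δ, ins E Xᶜ = k + δ := ⟨ins E Xᶜ - k, by omega⟩
  have hEl : 25 * ins E P ≤ 9 * k + 125 := by have := hX2 c; omega
  have hXP : Disjoint X P := by
    rw [Finset.disjoint_left]; intro v; simp only [hP, Finset.mem_erase, Finset.mem_compl]; tauto
  have hPm : ∀ v ∈ P, jn E Xᶜ v ≤ k / 2 := by
    intro v hv
    have h3 : Xᶜ = P ∪ {c} := by
      ext u
      simp only [hP, hX, Finset.mem_union, Finset.mem_erase, Finset.mem_compl, Finset.mem_insert, Finset.mem_singleton]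
      grind
    rw [h3]
    have := jn_union_le E P {c} v
    have := h1 c v
    have := ins_erase E hloop P v hv
    omega
  have hnP : ins E (X ∪ P)ᶜ ≤ k := by
    have h3 : (X ∪ P)ᶜ ⊆ {c} := by
      intro v; simp only [hP, Finset.mem_erase, Finset.mem_compl, Finset.mem_union, Finset.mem_singleton]; tauto
    have := ins_mono E h3
    rw [ins_singleton E hloop] at this
    omega
  by_cases hc1 : ∃ S ⊆ P, k ≤ ins E X + ∑ v ∈ S, jn E X v ∧ tch E X S + 2 ≤ δ
  · obtain ⟨S, hSP, h1, h2⟩ := hc1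
    exact case1 E hloop k δ X P hXP hδ (by omega) 2 (by omega) (fun v _ => hX2 v) (by omega)
      (by omega) (by omega) hPm hnP S hSP h1 h2
  push Not at hc1
  set R : Finset V := (E.filter (fun e => e.1 ∈ P ∧ e.2 ∈ P)).image Prod.fst with hR
  have hRc : R.card ≤ ins E P := Finset.card_image_le
  have hRP : R ⊆ P := by
    intro v hv
    simp only [hR, Finset.mem_image, Finset.mem_filter] at hv
    obtain ⟨e, he, rfl⟩ := hv
    exact he.2.1
  have hZ0 : ins E (P \ R) = 0 := by
    unfold ins
    rw [Finset.card_eq_zero, Finset.filter_eq_empty_iff]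
    rintro e he ⟨h1, h2⟩
    rw [Finset.mem_sdiff] at h1 h2
    apply h1.2
    simp only [hR, Finset.mem_image, Finset.mem_filter]
    exact ⟨e, ⟨he, h1.1, h2.1⟩, rfl⟩
  have hsumc : ins E X + ∑ v ∈ Xᶜ, jn E X v + ins E Xᶜ = E.card := by
    have := split3 E ∅ Xᶜ (by simp)
    rw [Finset.empty_union, compl_compl, Finset.compl_empty, ins_univ] at this
    exact this
  have hsum1 : jn E X c + ∑ v ∈ P, jn E X v = ∑ v ∈ Xᶜ, jn E X v :=
    Finset.add_sum_erase _ _ (by simp [hX, hac.symm, hbc.symm])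
  have hsum2 := Finset.sum_sdiff (f := fun v => jn E X v) hRP
  have hsum3 : ∑ v ∈ R, jn E X v ≤ R.card • 2 := Finset.sum_le_card_nsmul _ _ _ (fun v _ => hX2 v)
  rw [smul_eq_mul] at hsum3
  have hXc2 := hX2 c
  obtain ⟨Z, hZ, hZ1, hZ2⟩ := exists_min_sub (fun v => jn E X v) (P \ R) (k + 2 - ins E X) (by omega)
  have hZi : ins E Z = 0 := by have := ins_mono E hZ; omega
  have hZP : Z ⊆ P := hZ.trans Finset.sdiff_subset
  have hXZ : Disjoint X Z := Finset.disjoint_of_subset_right hZP hXP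
  have hZu : ∑ v ∈ Z, jn E X v + ins E X ≤ k + 3 := by
    rcases Finset.eq_empty_or_nonempty Z with h | ⟨v, hv⟩
    · rw [h, Finset.sum_empty]; omega
    · have := hZ2 v hv
      have := hX2 v
      omega
  have hZpos : ∀ v ∈ Z, 1 ≤ jn E X v := by
    intro v hv
    have := hZ2 v hv
    omega
  have htch := hc1 Z hZP (by omega)
  have h3 := split3 E X Z hXZ
  have h4 := tch_add E X Z
  set Y := (X ∪ Z)ᶜ with hY
  obtain ⟨r, hrinj, hrb⟩ := rank_exists (fun v => jn E Y v)
  refine exact_good E k X Z Y ?_ hXZ ?_ ?_ r hrinj.injOn ?_ ?_ ?_ ?_ ?_ ?_ ?_ ?_ ?_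
  · intro v; simp only [hY, Finset.mem_compl, Finset.mem_union]; tauto
  · rw [Finset.disjoint_left]; intro a; simp only [hY, Finset.mem_compl, Finset.mem_union]; tauto
  · rw [Finset.disjoint_left]; intro a; simp only [hY, Finset.mem_compl, Finset.mem_union]; tauto
  · omega
  · omega
  · intro v hv
    have ha := rank_split r hrinj Z v hv (fun u => jn E X u)
    have hbb := rank_split r hrinj Z v hv (fun u => jn E Y u)
    have hav := hX2 v
    by_cases hbv : jn E Y v ≤ 1
    · have : ∑ u ∈ Z with r u < r v, jn E Y u ≤ ∑ u ∈ Z with r u < r v, jn E X u := by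
        apply Finset.sum_le_sum
        intro u hu
        have h5 := hrb u v (Finset.mem_filter.1 hu).2
        have h6 := hZpos u (Finset.mem_filter.1 hu).1
        omega
      omega
    · have : ∑ u ∈ Z with r v < r u, jn E X u ≤ ∑ u ∈ Z with r v < r u, jn E Y u := by
        apply Finset.sum_le_sum
        intro u hu
        have h5 := hrb v u (Finset.mem_filter.1 hu).2
        have h6 := hX2 u
        omega
      omega
  · omega
  · omega
  · omega
  · omega
  · intro v hv
    have := hX2 v
    omega
  · intro v hv
    have h5 := hPm v (hZP hv)
    have h6 := jn_compl_le E X Z v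
    rw [← hY] at h6
    omega

lemma regimeW (E : Finset (V × V)) (hloop : ∀ e ∈ E, e.1 ≠ e.2) (hs : ∀ e ∈ E, (e.2, e.1) ∉ E)
    (k : ℕ) (hk : 1000 ≤ k) (hE : E.card = 3 * k + 1) (a b c : V) (hab : a ≠ b) (hac : a ≠ c)
    (hbc : b ≠ c)
    (ha : 22 * k ≤ 25 * jn E Finset.univ a) (hb : 22 * k ≤ 25 * jn E Finset.univ b)
    (hc : 22 * k ≤ 25 * jn E Finset.univ c) :
    ∃ w, Good E k w := by
  by_cases h1 : jn E Finset.univ a + jn E Finset.univ b ≤ 2 * k + 2 * jn E {a} b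
  · exact regimeW0 E hloop hs k hk hE a b c hab hac hbc ha hb hc h1
  by_cases h2 : jn E Finset.univ a + jn E Finset.univ c ≤ 2 * k + 2 * jn E {a} c
  · exact regimeW0 E hloop hs k hk hE a c b hac hab hbc.symm ha hc hb h2
  by_cases h3 : jn E Finset.univ b + jn E Finset.univ c ≤ 2 * k + 2 * jn E {b} c
  · exact regimeW0 E hloop hs k hk hE b c a hbc hab.symm hac.symm hb hc ha h3
  exfalso
  have i1 := ins_erase E hloop Finset.univ a (Finset.mem_univ _)
  have i2 := ins_erase E hloop (Finset.univ.erase a) b (by simp [hab.symm])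
  have i3 := ins_erase E hloop ((Finset.univ.erase a).erase b) c (by simp [hac.symm, hbc.symm])
  have sp1 : jn E Finset.univ b = jn E (Finset.univ.erase a) b + jn E {a} b := by
    rw [← jn_univ_split E hloop _ _ (by simp)]; congr 1; ext; simp
  have sp2 : jn E Finset.univ c = jn E ((Finset.univ.erase a).erase b) c + (jn E {a} c + jn E {b} c) := by
    rw [← jn_univ_split E hloop {a} {b} (by simpa using hab), ← jn_univ_split E hloop _ _ (by simp)]
    congr 1; ext; simp; tauto
  rw [ins_univ] at i1
  omega

end TES

namespace TES
set_option linter.unusedSectionVars false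

variable {V : Type*} [Fintype V] [DecidableEq V]

/-- product expectation -/
def Ex (p : Fin 17 → ℚ) (F : (V → Fin 17) → ℚ) : ℚ := ∑ f : V → Fin 17, (∏ v, p (f v)) * F f

lemma Ex_const (p : Fin 17 → ℚ) (hp : ∑ x, p x = 1) (c : ℚ) : Ex (V := V) p (fun _ => c) = c := by
  unfold Ex
  rw [← Finset.sum_mul]
  have := Finset.prod_univ_sum (fun _ : V => (Finset.univ : Finset (Fin 17))) (fun _ x => p x)
  simp only [hp, Finset.prod_const_one, Fintype.piFinset_univ] at this
  rw [← this, one_mul]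

lemma Ex_sum {ι : Type*} (p : Fin 17 → ℚ) (s : Finset ι) (F : ι → (V → Fin 17) → ℚ) :
    Ex p (fun f => ∑ i ∈ s, F i f) = ∑ i ∈ s, Ex p (F i) := by
  unfold Ex
  simp only [Finset.mul_sum]
  exact Finset.sum_comm

lemma Ex_smul (p : Fin 17 → ℚ) (c : ℚ) (F : (V → Fin 17) → ℚ) :
    Ex p (fun f => c * F f) = c * Ex p F := by
  unfold Ex
  rw [Finset.mul_sum]
  exact Finset.sum_congr rfl (fun f _ => by ring)

lemma Ex_mono (p : Fin 17 → ℚ) (hp0 : ∀ x, 0 ≤ p x) (F G : (V → Fin 17) → ℚ) (h : ∀ f, F f ≤ G f) :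
    Ex p F ≤ Ex p G := by
  unfold Ex
  exact Finset.sum_le_sum (fun f _ => mul_le_mul_of_nonneg_left (h f)
    (Finset.prod_nonneg (fun v _ => hp0 _)))

lemma Ex_exists (p : Fin 17 → ℚ) (hp0 : ∀ x, 0 ≤ p x) (hp : ∑ x, p x = 1) (F : (V → Fin 17) → ℚ)
    (h : Ex p F < 1) : ∃ f, F f < 1 := by
  by_contra hc
  push Not at hc
  have := Ex_mono p hp0 (fun _ => 1) F hc
  rw [Ex_const p hp] at this
  linarith

lemma Ex_resample (p : Fin 17 → ℚ) (hp : ∑ x, p x = 1) (v : V) (F : (V → Fin 17) → ℚ) :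
    Ex p F = Ex p (fun f => ∑ x, p x * F (Function.update f v x)) := by
  unfold Ex
  have hW : ∀ f : V → Fin 17, ∏ u, p (f u) = p (f v) * ∏ u ∈ Finset.univ.erase v, p (f u) :=
    fun f => (Finset.mul_prod_erase _ (fun u => p (f u)) (Finset.mem_univ v)).symm
  have hW' : ∀ (f : V → Fin 17) (x : Fin 17), ∏ u ∈ Finset.univ.erase v, p (Function.update f v x u) =
      ∏ u ∈ Finset.univ.erase v, p (f u) := by
    intro f x
    apply Finset.prod_congr rfl
    intro u hu
    rw [Function.update_of_ne (Finset.ne_of_mem_erase hu)]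
  let inv : (V → Fin 17) × Fin 17 → (V → Fin 17) × Fin 17 := fun q => (Function.update q.1 v q.2, q.1 v)
  have hinv : Function.Involutive inv := by
    rintro ⟨f, x⟩
    simp [inv]
  have h1 : ∑ f : V → Fin 17, (∏ u, p (f u)) * F f =
      ∑ q : (V → Fin 17) × Fin 17, (∏ u, p (q.1 u)) * p q.2 * F q.1 := by
    rw [Fintype.sum_prod_type]
    apply Finset.sum_congr rfl
    intro f _
    change _ = ∑ y, (∏ u, p (f u)) * p y * F f
    rw [← Finset.sum_mul, ← Finset.mul_sum, hp, mul_one]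
  rw [h1, ← Equiv.sum_comp (hinv.toPerm), Fintype.sum_prod_type]
  apply Finset.sum_congr rfl
  intro f _
  rw [Finset.mul_sum]
  apply Finset.sum_congr rfl
  intro x _
  simp only [Function.Involutive.coe_toPerm, inv]
  rw [hW, hW', hW f, Function.update_self]
  ring

lemma Ex_indep (p : Fin 17 → ℚ) (hp : ∑ x, p x = 1) (v : V) (H K : (V → Fin 17) → ℚ)
    (hH : ∀ f x, H (Function.update f v x) = H f) :
    Ex p (fun f => K f * H f) = Ex p (fun f => (∑ x, p x * K (Function.update f v x)) * H f) := by
  rw [Ex_resample p hp v]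
  congr 1
  ext f
  rw [Finset.sum_mul]
  apply Finset.sum_congr rfl
  intro x _
  rw [hH]; ring

lemma varA (p : Fin 17 → ℚ) (hp : ∑ x, p x = 1) (ψ : Fin 17 → ℚ)
    (hψ : ∀ x, ψ x * ψ x = ψ x) (Z : Finset V) (a : V → ℚ) :
    Ex p (fun f => (∑ v ∈ Z, a v * (ψ (f v) - ∑ x, p x * ψ x)) ^ 2) ≤ 1 / 4 * ∑ v ∈ Z, a v ^ 2 := by
  set μ := ∑ x, p x * ψ x with hμ
  have h0 : ∑ x, p x * (ψ x - μ) = 0 := by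
    simp only [mul_sub, Finset.sum_sub_distrib, ← Finset.sum_mul, hp, ← hμ]; ring
  have hz : ∀ u v : V, u ≠ v → Ex p (fun f => (ψ (f u) - μ) * (ψ (f v) - μ)) = 0 := by
    intro u v huv
    rw [Ex_indep p hp u (fun f => ψ (f v) - μ) (fun f => ψ (f u) - μ)
      (fun f x => by simp [Function.update_of_ne huv.symm])]
    simp only [Function.update_self, h0, zero_mul]
    exact Ex_const p hp 0
  have hd : ∀ v : V, Ex p (fun f => (ψ (f v) - μ) * (ψ (f v) - μ)) ≤ 1 / 4 := by
    intro v
    rw [Ex_resample p hp v]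
    simp only [Function.update_self]
    rw [Ex_const p hp]
    have : ∀ x, p x * ((ψ x - μ) * (ψ x - μ)) = p x * ψ x - 2 * μ * (p x * ψ x) + μ ^ 2 * p x := by
      intro x
      have := hψ x
      linear_combination (p x) * this
    simp only [this, Finset.sum_add_distrib, Finset.sum_sub_distrib, ← Finset.mul_sum, hp, ← hμ]
    nlinarith [sq_nonneg (μ - 1 / 2)]
  have he : ∀ f : V → Fin 17, (∑ v ∈ Z, a v * (ψ (f v) - μ)) ^ 2 =
      ∑ u ∈ Z, ∑ v ∈ Z, (a u * a v) * ((ψ (f u) - μ) * (ψ (f v) - μ)) := by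
    intro f
    rw [sq, Finset.sum_mul_sum]
    exact Finset.sum_congr rfl (fun u _ => Finset.sum_congr rfl (fun v _ => by ring))
  simp only [he]
  rw [Ex_sum]
  rw [Finset.mul_sum]
  apply Finset.sum_le_sum
  intro u hu
  rw [Ex_sum, Finset.sum_eq_single u]
  · rw [Ex_smul]
    have := hd u
    nlinarith [mul_self_nonneg (a u)]
  · intro v _ hvu
    rw [Ex_smul, hz u v hvu.symm, mul_zero]
  · intro h; exact absurd hu h

lemma varC (p : Fin 17 → ℚ) (hp0 : ∀ x, 0 ≤ p x) (hp : ∑ x, p x = 1) (φ : Fin 17 → Fin 17 → ℚ)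
    (hφ0 : ∀ x y, 0 ≤ φ x y) (hφ1 : ∀ x y, φ x y ≤ 1) (hφs : ∀ x y, φ x y = φ y x)
    (g : Fin 17 → ℚ) (hg : ∀ x, g x = ∑ y, p y * φ x y) (μ : ℚ) (hμ : μ = ∑ x, p x * g x)
    (E : Finset (V × V)) (hloop : ∀ e ∈ E, e.1 ≠ e.2) (hs : ∀ e ∈ E, (e.2, e.1) ∉ E)
    (D : ℕ) (hD : ∀ e ∈ E, (E.filter (fun e' => e'.1 = e.1 ∨ e'.2 = e.1)).card ≤ D ∧
      (E.filter (fun e' => e'.1 = e.2 ∨ e'.2 = e.2)).card ≤ D) :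
    Ex p (fun f => (∑ e ∈ E, (φ (f e.1) (f e.2) - μ)) ^ 2) ≤
      E.card * (1 + 2 * D * (∑ x, p x * g x ^ 2 - μ ^ 2)) := by
  set ν := ∑ x, p x * g x ^ 2 - μ ^ 2 with hν
  have h0 : ∑ x, p x * (g x - μ) = 0 := by
    simp only [mul_sub, Finset.sum_sub_distrib, ← Finset.sum_mul, hp, ← hμ]; ring
  have hν' : ∑ x, p x * ((g x - μ) * (g x - μ)) = ν := by
    have : ∀ x, p x * ((g x - μ) * (g x - μ)) = p x * g x ^ 2 - 2 * μ * (p x * g x) + μ ^ 2 * p x := by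
      intro x; ring
    simp only [this, Finset.sum_add_distrib, Finset.sum_sub_distrib, ← Finset.mul_sum, hp, ← hμ]
    rw [hν]; ring
  have hν0 : 0 ≤ ν := by
    rw [← hν']
    exact Finset.sum_nonneg (fun x _ => mul_nonneg (hp0 x) (mul_self_nonneg _))
  have hin : ∀ x, ∑ y, p y * (φ x y - μ) = g x - μ := by
    intro x
    simp only [mul_sub, Finset.sum_sub_distrib, ← Finset.sum_mul, hp, ← hg]; ring
  have hμ0 : 0 ≤ μ := by
    rw [hμ]
    refine Finset.sum_nonneg (fun x _ => mul_nonneg (hp0 x) ?_)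
    rw [hg]
    exact Finset.sum_nonneg (fun y _ => mul_nonneg (hp0 y) (hφ0 x y))
  have hg1 : ∀ x, g x ≤ 1 := by
    intro x
    rw [hg, ← hp]
    exact Finset.sum_le_sum (fun y _ => by nlinarith [hp0 y, hφ1 x y])
  have hμ1 : μ ≤ 1 := by
    rw [hμ, ← hp]
    exact Finset.sum_le_sum (fun y _ => by nlinarith [hp0 y, hg1 y])
  -- resampling second endpoint
  have step : ∀ (a b : V) (H : (V → Fin 17) → ℚ), a ≠ b → (∀ f x, H (Function.update f b x) = H f) →
      Ex p (fun f => (φ (f a) (f b) - μ) * H f) = Ex p (fun f => (g (f a) - μ) * H f) := by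
    intro a b H hab hH
    rw [Ex_indep p hp b H (fun f => φ (f a) (f b) - μ) hH]
    simp only [Function.update_self, Function.update_of_ne hab, hin]
  have hz : ∀ a b c d : V, a ≠ b → a ≠ c → a ≠ d → b ≠ c → b ≠ d →
      Ex p (fun f => (φ (f a) (f b) - μ) * (φ (f c) (f d) - μ)) = 0 := by
    intro a b c d hab hac had hbc hbd
    rw [step a b (fun f => φ (f c) (f d) - μ) hab
      (fun f x => by simp only [Function.update_of_ne hbc.symm, Function.update_of_ne hbd.symm])]
    rw [Ex_indep p hp a (fun f => φ (f c) (f d) - μ) (fun f => g (f a) - μ)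
      (fun f x => by simp only [Function.update_of_ne hac.symm, Function.update_of_ne had.symm])]
    simp only [Function.update_self, h0, zero_mul]
    exact Ex_const p hp 0
  have hsh : ∀ a b c : V, a ≠ b → a ≠ c → b ≠ c →
      Ex p (fun f => (φ (f a) (f b) - μ) * (φ (f a) (f c) - μ)) = ν := by
    intro a b c hab hac hbc
    rw [step a b (fun f => φ (f a) (f c) - μ) hab
      (fun f x => by simp only [Function.update_of_ne hbc.symm, Function.update_of_ne hab])]
    have : (fun f : V → Fin 17 => (g (f a) - μ) * (φ (f a) (f c) - μ)) =
      (fun f => (φ (f a) (f c) - μ) * (g (f a) - μ)) := by ext f; ring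
    rw [this, step a c (fun f => g (f a) - μ) hac
      (fun f x => by simp only [Function.update_of_ne hac])]
    rw [Ex_resample p hp a]
    simp only [Function.update_self]
    rw [Ex_const p hp, hν']
  have heq : ∀ a b : V, Ex p (fun f => (φ (f a) (f b) - μ) * (φ (f a) (f b) - μ)) ≤ 1 := by
    intro a b
    rw [← Ex_const (V := V) p hp 1]
    apply Ex_mono p hp0
    intro f
    nlinarith [hφ0 (f a) (f b), hφ1 (f a) (f b)]
  have he : ∀ f : V → Fin 17, (∑ e ∈ E, (φ (f e.1) (f e.2) - μ)) ^ 2 =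
      ∑ e ∈ E, ∑ e' ∈ E, ((φ (f e.1) (f e.2) - μ) * (φ (f e'.1) (f e'.2) - μ)) := by
    intro f
    rw [sq, Finset.sum_mul_sum]
  simp only [he]
  rw [Ex_sum, ← nsmul_eq_mul]
  apply Finset.sum_le_card_nsmul
  intro e hee
  rw [Ex_sum]
  have hb : ∀ e' ∈ E, Ex p (fun f => (φ (f e.1) (f e.2) - μ) * (φ (f e'.1) (f e'.2) - μ)) ≤
      (if e' = e then 1 else 0) + ((if e'.1 = e.1 ∨ e'.2 = e.1 then ν else 0) +
        (if e'.1 = e.2 ∨ e'.2 = e.2 then ν else 0)) := by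
    intro e' he'
    obtain ⟨a, b⟩ := e
    obtain ⟨c, d⟩ := e'
    have hab : a ≠ b := hloop _ hee
    have hcd : c ≠ d := hloop _ he'
    have hs1 := hs _ hee
    simp only at hs1 ⊢
    have n1 : (0:ℚ) ≤ (if c = a ∨ d = a then ν else 0) := by split_ifs <;> simp [hν0]
    have n2 : (0:ℚ) ≤ (if c = b ∨ d = b then ν else 0) := by split_ifs <;> simp [hν0]
    have n3 : (0:ℚ) ≤ (if ((c, d) : V × V) = (a, b) then 1 else 0) := by split_ifs <;> simp
    by_cases h1 : c = a
    · subst h1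
      by_cases h2 : d = b
      · subst h2
        have := heq c d
        rw [if_pos rfl]
        linarith
      · have := hsh c b d hab hcd (Ne.symm h2)
        rw [this, if_pos (Or.inl rfl)]
        linarith
    · by_cases h2 : d = a
      · subst h2
        by_cases h3 : c = b
        · subst h3; exact absurd he' hs1
        · have := hsh d b c hab hcd.symm (Ne.symm h3)
          have h4 : (fun f : V → Fin 17 => (φ (f d) (f b) - μ) * (φ (f c) (f d) - μ)) =
            (fun f : V → Fin 17 => (φ (f d) (f b) - μ) * (φ (f d) (f c) - μ)) := by
            ext f; rw [hφs (f c) (f d)]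
          rw [h4, this, if_pos (Or.inr rfl)]
          linarith
      · by_cases h3 : c = b
        · subst h3
          have := hsh c a d hab.symm hcd (Ne.symm h2)
          have h4 : (fun f : V → Fin 17 => (φ (f a) (f c) - μ) * (φ (f c) (f d) - μ)) =
            (fun f : V → Fin 17 => (φ (f c) (f a) - μ) * (φ (f c) (f d) - μ)) := by
            ext f; rw [hφs (f c) (f a)]
          rw [h4, this, if_pos (c := c = c ∨ d = c) (Or.inl rfl)]
          linarith
        · by_cases h4 : d = b
          · subst h4
            have := hsh d a c hab.symm hcd.symm (Ne.symm h1)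
            have h4 : (fun f : V → Fin 17 => (φ (f a) (f d) - μ) * (φ (f c) (f d) - μ)) =
              (fun f : V → Fin 17 => (φ (f d) (f a) - μ) * (φ (f d) (f c) - μ)) := by
              ext f; rw [hφs (f d) (f a), hφs (f d) (f c)]
            rw [h4, this, if_pos (c := c = d ∨ d = d) (Or.inr rfl)]
            linarith
          · rw [hz a b c d hab (Ne.symm h1) (Ne.symm h2) (Ne.symm h3) (Ne.symm h4)]
            linarith
  refine (Finset.sum_le_sum hb).trans ?_
  rw [Finset.sum_add_distrib, Finset.sum_add_distrib, Finset.sum_ite_eq' , if_pos hee,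
    ← Finset.sum_filter, ← Finset.sum_filter, Finset.sum_const, Finset.sum_const, nsmul_eq_mul, nsmul_eq_mul]
  have d1 : (((E.filter (fun e' => e'.1 = e.1 ∨ e'.2 = e.1)).card : ℕ) : ℚ) ≤ D := by
    exact_mod_cast (hD e hee).1
  have d2 : (((E.filter (fun e' => e'.1 = e.2 ∨ e'.2 = e.2)).card : ℕ) : ℚ) ≤ D := by
    exact_mod_cast (hD e hee).2
  have := mul_le_mul_of_nonneg_right d1 hν0
  have := mul_le_mul_of_nonneg_right d2 hν0
  linarith

end TES

namespace TES
set_option linter.unusedSectionVars false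

variable {V : Type*} [Fintype V] [DecidableEq V]

/-- number of edges with level sum at most j -/
def lc (E : Finset (V × V)) (l : V → ℕ) (j : ℕ) : ℕ := (E.filter (fun e => l e.1 + l e.2 ≤ j)).card

lemma side_low (E : Finset (V × V)) (k : ℕ) (l u : V → ℕ)
    (h1 : ∀ v, 16 * u v < l v * k + 16) 
    (hl : ∀ j < 16, (j + 1) * k + 48 ≤ 16 * lc E l j) (x : ℕ) (hx : x < k) :
    x + 2 ≤ (E.filter (fun e => u e.1 + u e.2 ≤ x)).card := by
  set j := (16 * x - 16) / k with hj
  have hjk : j * k ≤ 16 * x - 16 := Nat.div_mul_le_self _ _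
  have hjk2 : 16 * x - 16 < (j + 1) * k := by
    have := Nat.lt_div_mul_add (a := 16 * x - 16) (b := k) (by omega)
    rw [← hj] at this
    rw [Nat.add_mul]; omega
  have hj16 : j < 16 := by
    by_contra hc
    have : 16 * k ≤ j * k := Nat.mul_le_mul_right _ (by omega)
    omega
  have h3 := hl j hj16
  have h4 : lc E l j ≤ (E.filter (fun e => u e.1 + u e.2 ≤ x)).card := by
    apply Finset.card_le_card
    intro e he
    simp only [Finset.mem_filter] at he ⊢
    refine ⟨he.1, ?_⟩
    have h5 := h1 e.1
    have h6 := h1 e.2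
    by_cases h0 : j = 0
    · have h7 : l e.1 = 0 := by omega
      have h8 : l e.2 = 0 := by omega
      rw [h7] at h5; rw [h8] at h6
      omega
    · have h7 : (l e.1 + l e.2) * k ≤ j * k := Nat.mul_le_mul_right _ he.2
      have h8 : 1 * k ≤ j * k := Nat.mul_le_mul_right _ (by omega)
      rw [Nat.add_mul] at h7
      omega
  omega

lemma side_up (E : Finset (V × V)) (k : ℕ) (l u : V → ℕ)
    (h1 : ∀ v, l v * k < 16 * u v + 16) 
    (hl : ∀ j < 16, 16 * lc E l j + 16 ≤ 16 * k + j * k) (x : ℕ) (hx : x + 1 < k) :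
    (E.filter (fun e => u e.1 + u e.2 ≤ x)).card ≤ x + k + 1 := by
  set j := (16 * x + 31) / k with hj
  have hjk : j * k ≤ 16 * x + 31 := Nat.div_mul_le_self _ _
  have hj16 : j < 16 := by
    by_contra hc
    have : 16 * k ≤ j * k := Nat.mul_le_mul_right _ (by omega)
    omega
  have h3 := hl j hj16
  have h4 : (E.filter (fun e => u e.1 + u e.2 ≤ x)).card ≤ lc E l j := by
    apply Finset.card_le_card
    intro e he
    simp only [Finset.mem_filter] at he ⊢
    refine ⟨he.1, ?_⟩
    have h5 := h1 e.1
    have h6 := h1 e.2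
    rw [hj, Nat.le_div_iff_mul_le (by omega), Nat.add_mul]
    omega
  omega

lemma level_good (E : Finset (V × V)) (k : ℕ) (hE : E.card = 3 * k + 1) (l : V → ℕ)
    (hl16 : ∀ v, l v ≤ 16)
    (h1 : ∀ j < 16, (j + 1) * k + 48 ≤ 16 * lc E l j)
    (h2 : ∀ j < 16, 16 * lc E l j + 16 ≤ 16 * k + j * k)
    (h3 : ∀ j < 16, (j + 1) * k + 48 ≤ 16 * lc E (fun v => 16 - l v) j)
    (h4 : ∀ j < 16, 16 * lc E (fun v => 16 - l v) j + 16 ≤ 16 * k + j * k) :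
    ∃ w, Good E k w := by
  set w : V → ℕ := fun v => l v * k / 16 with hw
  have hwk : ∀ v, w v ≤ k := by
    intro v
    have : l v * k ≤ 16 * k := Nat.mul_le_mul_right _ (hl16 v)
    simp only [hw]; omega
  have hm : ∀ v, (16 - l v) * k + l v * k = 16 * k := by
    intro v
    rw [← Nat.add_mul, Nat.sub_add_cancel (hl16 v)]
  have a1 := side_low E k l w (fun v => by simp only [hw]; omega) h1
  have a2 := side_up E k l w (fun v => by simp only [hw]; omega) h2
  have b1 := side_low E k (fun v => 16 - l v) (fun v => k - w v)
    (fun v => by have := hm v; have := hwk v; simp only [hw] at *; omega) h3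
  have b2 := side_up E k (fun v => 16 - l v) (fun v => k - w v)
    (fun v => by have := hm v; have := hwk v; simp only [hw] at *; omega) h4
  have hopp : ∀ x, x + 1 = k → (E.filter (fun e => w e.1 + w e.2 ≤ x)).card +
      (E.filter (fun e => (k - w e.1) + (k - w e.2) ≤ x)).card ≤ 3 * k + 1 := by
    intro x hx
    rw [← hE, ← Finset.card_union_of_disjoint]
    · exact Finset.card_le_card (Finset.union_subset (Finset.filter_subset _ _) (Finset.filter_subset _ _))
    · rw [Finset.disjoint_left]
      intro e he he'
      simp only [Finset.mem_filter] at he he'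
      have := hwk e.1
      have := hwk e.2
      omega
  refine ⟨w, hwk, fun x hx => ⟨⟨(Nat.le_succ _).trans (a1 x hx), ?_⟩, ⟨(Nat.le_succ _).trans (b1 x hx), ?_⟩⟩⟩
  · by_cases hx1 : x + 1 < k
    · exact a2 x hx1
    · have h5 := hopp x (by omega)
      have h6 := b1 x hx
      omega
  · by_cases hx1 : x + 1 < k
    · exact b2 x hx1
    · have h5 := hopp x (by omega)
      have h6 := a1 x hx
      omega

lemma split_lemma (a : V → ℕ) (c D : ℕ) (Big Z : Finset V) (hBig : Big.card ≤ 2)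
    (hZ : ∀ v ∈ Z, v ∉ Big) (hD : ∀ v ∈ Big, a v ≤ D) (hc : ∀ v ∈ Z, a v ≤ c) :
    ∃ S T : Finset V, S ∪ T = Big ∪ Z ∧ Disjoint S T ∧ ∑ v ∈ T, a v ≤ ∑ v ∈ S, a v ∧
      (∑ v ∈ S, a v ≤ ∑ v ∈ T, a v + c ∨ ∑ v ∈ S, a v ≤ D) := by
  induction Z using Finset.induction_on with
  | empty =>
    rcases Nat.lt_or_ge Big.card 2 with h | h
    · refine ⟨Big, ∅, by simp, by simp, by simp, Or.inr ?_⟩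
      rcases Finset.eq_empty_or_nonempty Big with h0 | ⟨x, hx⟩
      · simp [h0]
      · have : Big = {x} := Finset.eq_singleton_iff_unique_mem.2 ⟨hx, fun y hy =>
          Finset.card_le_one.1 (Nat.lt_succ_iff.1 h) y hy x hx⟩
        rw [this, Finset.sum_singleton]
        exact hD x hx
    · obtain ⟨p, q, hpq, rfl⟩ := Finset.card_eq_two.1 (le_antisymm hBig h)
      rcases le_total (a q) (a p) with h | h
      · exact ⟨{p}, {q}, by ext; simp, by simpa using hpq, by simpa using h,
          Or.inr (by simpa using hD p (by simp))⟩
      · exact ⟨{q}, {p}, by ext; simp; tauto, by simpa using hpq.symm, by simpa using h,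
          Or.inr (by simpa using hD q (by simp))⟩
  | insert z Z hz ih =>
    obtain ⟨S, T, h1, h2, h3, h4⟩ := ih (fun v hv => hZ v (Finset.mem_insert_of_mem hv))
      (fun v hv => hc v (Finset.mem_insert_of_mem hv))
    have hzB := hZ z (Finset.mem_insert_self _ _)
    have hza := hc z (Finset.mem_insert_self _ _)
    have hzn : z ∉ S ∪ T := by rw [h1]; simp [hzB, hz]
    rw [Finset.mem_union, not_or] at hzn
    have hsum : ∑ v ∈ insert z T, a v = a z + ∑ v ∈ T, a v := Finset.sum_insert hzn.2
    have hu : S ∪ insert z T = Big ∪ insert z Z := by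
      rw [Finset.union_insert, h1, Finset.union_insert]
    have hd : Disjoint S (insert z T) := Finset.disjoint_insert_right.2 ⟨hzn.1, h2⟩
    rcases le_total (∑ v ∈ insert z T, a v) (∑ v ∈ S, a v) with h5 | h5
    · exact ⟨S, insert z T, hu, hd, h5, by omega⟩
    · exact ⟨insert z T, S, by rw [Finset.union_comm, hu], hd.symm, h5, by omega⟩

end TES

namespace TES
set_option linter.unusedSectionVars false

variable {V : Type*} [Fintype V] [DecidableEq V]

def mA (p : Fin 17 → ℚ) (lev : Fin 17 → ℕ) (j : ℕ) : ℚ := ∑ x, p x * (if lev x ≤ j then 1 else 0)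
def gC (p : Fin 17 → ℚ) (lev : Fin 17 → ℕ) (j : ℕ) (x : Fin 17) : ℚ :=
  ∑ y, p y * (if lev x + lev y ≤ j then 1 else 0)
def mC (p : Fin 17 → ℚ) (lev : Fin 17 → ℕ) (j : ℕ) : ℚ := ∑ x, p x * gC p lev j x
def vC (p : Fin 17 → ℚ) (lev : Fin 17 → ℕ) (j : ℕ) : ℚ := ∑ x, p x * gC p lev j x ^ 2 - mC p lev j ^ 2

lemma lt_of_div_sq {d α : ℚ} (hα : 0 < α) (h : d ^ 2 / α ^ 2 < 1) : |d| < α := by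
  rw [div_lt_one (by positivity)] at h
  exact abs_lt_of_sq_lt_sq h hα.le

lemma rand_core (p : Fin 17 → ℚ) (hp0 : ∀ x, 0 ≤ p x) (hp : ∑ x, p x = 1)
    (Z : Finset V) (a0 a1 : V → ℚ) (F : Finset (V × V)) (hloop : ∀ e ∈ F, e.1 ≠ e.2)
    (hs : ∀ e ∈ F, (e.2, e.1) ∉ F)
    (D : ℕ) (hD : ∀ e ∈ F, (F.filter (fun e' => e'.1 = e.1 ∨ e'.2 = e.1)).card ≤ D ∧
      (F.filter (fun e' => e'.1 = e.2 ∨ e'.2 = e.2)).card ≤ D)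
    (l0 l1 : Fin 17 → ℕ) (α β : ℚ) (hα : 0 < α) (hβ : 0 < β)
    (h : 4 * (∑ v ∈ Z, a0 v ^ 2 + ∑ v ∈ Z, a1 v ^ 2) / α ^ 2 +
      F.card * (32 + 2 * D * ∑ j ∈ Finset.range 16, (vC p l0 j + vC p l1 j)) / β ^ 2 < 1) :
    ∃ f : V → Fin 17, ∀ j < 16,
      |∑ v ∈ Z, a0 v * ((if l0 (f v) ≤ j then 1 else 0) - mA p l0 j)| < α ∧
      |∑ v ∈ Z, a1 v * ((if l1 (f v) ≤ j then 1 else 0) - mA p l1 j)| < α ∧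
      |∑ e ∈ F, ((if l0 (f e.1) + l0 (f e.2) ≤ j then 1 else 0) - mC p l0 j)| < β ∧
      |∑ e ∈ F, ((if l1 (f e.1) + l1 (f e.2) ≤ j then 1 else 0) - mC p l1 j)| < β := by
  have vA : ∀ (l : Fin 17 → ℕ) (a : V → ℚ) (j : ℕ), Ex p (fun f =>
      (∑ v ∈ Z, a v * ((if l (f v) ≤ j then 1 else 0) - mA p l j)) ^ 2) ≤ 1 / 4 * ∑ v ∈ Z, a v ^ 2 := by
    intro l a j
    exact varA p hp (fun x => if l x ≤ j then 1 else 0) (fun x => by split_ifs <;> simp) Z a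
  have vCC : ∀ (l : Fin 17 → ℕ) (j : ℕ), Ex p (fun f =>
      (∑ e ∈ F, ((if l (f e.1) + l (f e.2) ≤ j then 1 else 0) - mC p l j)) ^ 2) ≤
      F.card * (1 + 2 * D * vC p l j) := by
    intro l j
    exact varC p hp0 hp (fun x y => if l x + l y ≤ j then 1 else 0)
      (fun x y => by split_ifs <;> simp) (fun x y => by split_ifs <;> simp)
      (fun x y => by rw [add_comm]) (gC p l j) (fun x => rfl) (mC p l j) rfl F hloop hs D hD
  obtain ⟨f, hf⟩ := Ex_exists p hp0 hp (fun f : V → Fin 17 => ∑ j ∈ Finset.range 16,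
    ((α ^ 2)⁻¹ * (∑ v ∈ Z, a0 v * ((if l0 (f v) ≤ j then 1 else 0) - mA p l0 j)) ^ 2 +
     (α ^ 2)⁻¹ * (∑ v ∈ Z, a1 v * ((if l1 (f v) ≤ j then 1 else 0) - mA p l1 j)) ^ 2 +
     (β ^ 2)⁻¹ * (∑ e ∈ F, ((if l0 (f e.1) + l0 (f e.2) ≤ j then 1 else 0) - mC p l0 j)) ^ 2 +
     (β ^ 2)⁻¹ * (∑ e ∈ F, ((if l1 (f e.1) + l1 (f e.2) ≤ j then 1 else 0) - mC p l1 j)) ^ 2)) (by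
    rw [Ex_sum]
    refine lt_of_le_of_lt (Finset.sum_le_sum (g := fun j =>
      (α ^ 2)⁻¹ * (1 / 4 * ∑ v ∈ Z, a0 v ^ 2) + (α ^ 2)⁻¹ * (1 / 4 * ∑ v ∈ Z, a1 v ^ 2) +
      (β ^ 2)⁻¹ * (F.card * (1 + 2 * D * vC p l0 j)) + (β ^ 2)⁻¹ * (F.card * (1 + 2 * D * vC p l1 j))) ?_) ?_
    · intro j _
      have hadd : ∀ F G : (V → Fin 17) → ℚ, Ex p (fun f => F f + G f) = Ex p F + Ex p G := by
        intro F G; unfold Ex; rw [← Finset.sum_add_distrib]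
        exact Finset.sum_congr rfl (fun f _ => by ring)
      rw [hadd, hadd, hadd, Ex_smul, Ex_smul, Ex_smul, Ex_smul]
      have i1 : (0:ℚ) ≤ (α ^ 2)⁻¹ := by positivity
      have i2 : (0:ℚ) ≤ (β ^ 2)⁻¹ := by positivity
      have := mul_le_mul_of_nonneg_left (vA l0 a0 j) i1
      have := mul_le_mul_of_nonneg_left (vA l1 a1 j) i1
      have := mul_le_mul_of_nonneg_left (vCC l0 j) i2
      have := mul_le_mul_of_nonneg_left (vCC l1 j) i2
      linarith
    · refine lt_of_eq_of_lt ?_ h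
      simp only [Finset.sum_add_distrib, ← Finset.mul_sum, Finset.sum_const, Finset.card_range,
        nsmul_eq_mul]
      push_cast
      ring)
  refine ⟨f, fun j hj => ?_⟩
  have i1 : (0:ℚ) ≤ (α ^ 2)⁻¹ := by positivity
  have i2 : (0:ℚ) ≤ (β ^ 2)⁻¹ := by positivity
  have hle := Finset.single_le_sum (f := fun j => 
    ((α ^ 2)⁻¹ * (∑ v ∈ Z, a0 v * ((if l0 (f v) ≤ j then 1 else 0) - mA p l0 j)) ^ 2 +
     (α ^ 2)⁻¹ * (∑ v ∈ Z, a1 v * ((if l1 (f v) ≤ j then 1 else 0) - mA p l1 j)) ^ 2 +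
     (β ^ 2)⁻¹ * (∑ e ∈ F, ((if l0 (f e.1) + l0 (f e.2) ≤ j then 1 else 0) - mC p l0 j)) ^ 2 +
     (β ^ 2)⁻¹ * (∑ e ∈ F, ((if l1 (f e.1) + l1 (f e.2) ≤ j then 1 else 0) - mC p l1 j)) ^ 2))
     (fun i _ => by positivity) (Finset.mem_range.2 hj)
  have hlt := lt_of_le_of_lt hle hf
  have q1 := mul_nonneg i1 (sq_nonneg (∑ v ∈ Z, a0 v * ((if l0 (f v) ≤ j then (1:ℚ) else 0) - mA p l0 j)))
  have q2 := mul_nonneg i1 (sq_nonneg (∑ v ∈ Z, a1 v * ((if l1 (f v) ≤ j then (1:ℚ) else 0) - mA p l1 j)))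
  have q3 := mul_nonneg i2 (sq_nonneg (∑ e ∈ F, ((if l0 (f e.1) + l0 (f e.2) ≤ j then (1:ℚ) else 0) - mC p l0 j)))
  have q4 := mul_nonneg i2 (sq_nonneg (∑ e ∈ F, ((if l1 (f e.1) + l1 (f e.2) ≤ j then (1:ℚ) else 0) - mC p l1 j)))
  refine ⟨lt_of_div_sq hα ?_, lt_of_div_sq hα ?_, lt_of_div_sq hβ ?_, lt_of_div_sq hβ ?_⟩ <;>
    rw [div_eq_inv_mul] <;> linarith

/-- integer versions -/
def Lc (n : ℕ → ℕ) (j : ℕ) : ℕ := ∑ x ∈ Finset.range (j + 1), n x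
def Sc (n : ℕ → ℕ) (j : ℕ) : ℕ := ∑ x ∈ Finset.range (j + 1), n x * Lc n (j - x)
def Qc (n : ℕ → ℕ) (j : ℕ) : ℕ := ∑ x ∈ Finset.range (j + 1), n x * Lc n (j - x) ^ 2

lemma sum_trunc (G : ℕ → ℚ) (j : ℕ) (hj : j < 16) :
    ∑ i ∈ Finset.range 17, (if i ≤ j then G i else 0) = ∑ i ∈ Finset.range (j + 1), G i := by
  rw [← Finset.sum_filter]
  apply Finset.sum_congr _ (fun _ _ => rfl)
  ext i
  simp only [Finset.mem_filter, Finset.mem_range]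
  omega

lemma mA_eval (p : Fin 17 → ℚ) (n : ℕ → ℕ) (lev : Fin 17 → ℕ) (hp : ∀ x, p x = n (lev x) / 15000)
    (hlev : ∀ G : ℕ → ℚ, ∑ x, G (lev x) = ∑ i ∈ Finset.range 17, G i) (j : ℕ) (hj : j < 16) :
    mA p lev j = Lc n j / 15000 := by
  unfold mA Lc
  simp only [hp]
  rw [hlev (fun i => (n i : ℚ) / 15000 * (if i ≤ j then 1 else 0))]
  simp only [mul_ite, mul_one, mul_zero]
  rw [sum_trunc _ j hj, ← Finset.sum_div]
  push_cast
  rfl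

lemma gC_eval (p : Fin 17 → ℚ) (n : ℕ → ℕ) (lev : Fin 17 → ℕ) (hp : ∀ x, p x = n (lev x) / 15000)
    (hlev : ∀ G : ℕ → ℚ, ∑ x, G (lev x) = ∑ i ∈ Finset.range 17, G i) (j : ℕ) (hj : j < 16) (x : Fin 17) :
    gC p lev j x = if lev x ≤ j then (Lc n (j - lev x) : ℚ) / 15000 else 0 := by
  unfold gC
  simp only [hp]
  rw [hlev (fun i => (n i : ℚ) / 15000 * (if lev x + i ≤ j then 1 else 0))]
  split_ifs with h
  · have : ∀ i, lev x + i ≤ j ↔ i ≤ j - lev x := fun i => by omega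
    simp only [mul_ite, mul_one, mul_zero, this]
    rw [sum_trunc _ (j - lev x) (by omega), ← Finset.sum_div, Lc]
    push_cast
    rfl
  · apply Finset.sum_eq_zero
    intro i _
    rw [if_neg (by omega), mul_zero]

lemma mC_eval (p : Fin 17 → ℚ) (n : ℕ → ℕ) (lev : Fin 17 → ℕ) (hp : ∀ x, p x = n (lev x) / 15000)
    (hlev : ∀ G : ℕ → ℚ, ∑ x, G (lev x) = ∑ i ∈ Finset.range 17, G i) (j : ℕ) (hj : j < 16) :
    mC p lev j = Sc n j / 15000 ^ 2 := by
  unfold mC Sc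
  simp only [gC_eval p n lev hp hlev j hj]
  simp only [hp]
  rw [hlev (fun i => (n i : ℚ) / 15000 * (if i ≤ j then (Lc n (j - i) : ℚ) / 15000 else 0))]
  simp only [mul_ite, mul_zero]
  rw [sum_trunc _ j hj]
  push_cast
  rw [Finset.sum_div]
  exact Finset.sum_congr rfl (fun i _ => by ring)

lemma vC_eval (p : Fin 17 → ℚ) (n : ℕ → ℕ) (lev : Fin 17 → ℕ) (hp : ∀ x, p x = n (lev x) / 15000)
    (hlev : ∀ G : ℕ → ℚ, ∑ x, G (lev x) = ∑ i ∈ Finset.range 17, G i) (j : ℕ) (hj : j < 16) :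
    vC p lev j = (15000 * Qc n j - (Sc n j : ℚ) ^ 2) / 15000 ^ 4 := by
  have : ∑ x, p x * gC p lev j x ^ 2 = Qc n j / 15000 ^ 3 := by
    unfold Qc
    simp only [gC_eval p n lev hp hlev j hj]
    simp only [hp]
    rw [hlev (fun i => (n i : ℚ) / 15000 * (if i ≤ j then (Lc n (j - i) : ℚ) / 15000 else 0) ^ 2)]
    have h2 : ∀ i, (n i : ℚ) / 15000 * (if i ≤ j then (Lc n (j - i) : ℚ) / 15000 else 0) ^ 2 =
      if i ≤ j then (n i : ℚ) / 15000 * ((Lc n (j - i) : ℚ) / 15000) ^ 2 else 0 := by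
      intro i; split_ifs <;> simp
    simp only [h2]
    rw [sum_trunc _ j hj]
    push_cast
    rw [Finset.sum_div]
    exact Finset.sum_congr rfl (fun i _ => by ring)
  rw [vC, this, mC_eval p n lev hp hlev j hj]
  ring

lemma hlev_id (G : ℕ → ℚ) : ∑ x : Fin 17, G (x : ℕ) = ∑ i ∈ Finset.range 17, G i :=
  Fin.sum_univ_eq_sum_range G 17

lemma hlev_rev (G : ℕ → ℚ) : ∑ x : Fin 17, G (16 - (x : ℕ)) = ∑ i ∈ Finset.range 17, G i := by
  rw [Fin.sum_univ_eq_sum_range (fun i => G (16 - i)) 17]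
  exact Finset.sum_range_reflect G 17

end TES

namespace TES
set_option linter.unusedSectionVars false

variable {V : Type*} [Fintype V] [DecidableEq V]

def fL (z c j : ℕ) : ℕ := z + c * j
def fsL (z c : ℕ) : ℕ → ℕ
  | 0 => 0
  | j + 1 => fsL z c j + fL z c j
def fsQ (z c : ℕ) : ℕ → ℕ
  | 0 => 0
  | j + 1 => fsQ z c j + fL z c j ^ 2
def fS (z c j : ℕ) : ℕ := z * fL z c j + c * fsL z c j
def fQ (z c j : ℕ) : ℕ := z * fL z c j ^ 2 + c * fsQ z c j
/-- variance sum -/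
def fv (z c : ℕ) : ℕ → ℕ
  | 0 => 0
  | j + 1 => fv z c j + (15000 * fQ z c j - fS z c j ^ 2)

/-- one-sided check at level `j`: lower bound uses `x1 y2`, upper uses `x2 y1` -/
def sideOK (z c x1 x2 y1 y2 e j : ℕ) : Bool :=
  Nat.ble (fS z c j) (15000 * fL z c j) &&
  (Nat.ble (16 * (x1 + y2) * fS z c j + (10000 * (j + 1) + 16 * (68 + e)) * 15000 ^ 2)
    (16 * (x1 * 15000 * fL z c j + 30000 * fS z c j)) &&
  Nat.ble (16 * (x2 * 15000 * fL z c j + 30000 * fS z c j) + 16 * (68 + e) * 15000 ^ 2)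
    (16 * (x2 + y1) * fS z c j + (160000 + 10000 * j) * 15000 ^ 2))

def allOK (f : ℕ → Bool) : ℕ → Bool
  | 0 => true
  | j + 1 => f j && allOK f j

def boxOK (p q e a1 a2 b1 b2 : ℕ) : Bool :=
  Nat.ble (p + q) 1000 && (Nat.ble 50 e &&
  (Nat.ble (600 * (fv (15 * p) (1000 - p - q) 16 + fv (15 * q) (1000 - p - q) 16) *
    (30000 - a1 - b1 + 1)) (74 * e ^ 2 * 15000 ^ 4) &&
  (allOK (sideOK (15 * p) (1000 - p - q) a1 a2 b1 b2 e) 16 &&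
   allOK (sideOK (15 * q) (1000 - p - q) b1 b2 a1 a2 e) 16)))

inductive Tr where
  | lf (p q e : ℕ)
  | na (c : ℕ) (l r : Tr)
  | nb (c : ℕ) (l r : Tr)

def leafOK (p q e a1 a2 b1 b2 : ℕ) : Bool :=
  if 15010 < a1 then
    boxOK p q e (max a1 b1) (min (min (min a2 (b2 + 8810)) 19406) (30001 - b1))
      (max b1 (a1 - 8810)) (min (min b2 a2) (30001 - a1))
  else
    boxOK p q e (max a1 b1) (min a2 (30001 - b1)) b1 (min (min b2 a2) (30001 - a1))

def chk : Tr → ℕ → ℕ → ℕ → ℕ → Bool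
  | .lf p q e, a1, a2, b1, b2 => leafOK p q e a1 a2 b1 b2
  | .na c l r, a1, a2, b1, b2 => chk l a1 c b1 b2 && chk r c a2 b1 b2
  | .nb c l r, a1, a2, b1, b2 => chk l a1 a2 b1 c && chk r a1 a2 c b2

def tree : Tr :=
  (.na 15011 (.nb 7505 (.na 7505 (.nb 3752 (.na 3752 (.nb 1876 (.lf 284 300 638) (.lf 288 288
    596)) (.na 5628 (.lf 260 316 595) (.lf 220 320 566))) (.nb 5628 (.lf 256 276 543) (.lf
    256 256 492))) (.na 11258 (.nb 3752 (.na 9381 (.lf 196 340 542) (.lf 160 352 513)) (.nb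
    5628 (.lf 188 300 486) (.lf 192 260 455))) (.nb 3752 (.na 13134 (.nb 1876 (.lf 132 392
    489) (.lf 132 356 458)) (.nb 1876 (.na 14072 (.lf 104 400 458) (.nb 938 (.na 14541 (.lf
    100 424 447) (.lf 88 424 437)) (.lf 92 412 430))) (.lf 96 384 428))) (.nb 5628 (.na
    13134 (.lf 144 336 432) (.lf 104 360 399)) (.lf 116 300 393))))) (.nb 11258 (.na 11258
    (.lf 208 208 423) (.lf 124 244 358)) (.lf 160 160 288))) (.nb 10595 (.nb 8398 (.nb 7299
    (.lf 92 364 325) (.lf 76 360 301)) (.na 17208 (.lf 84 344 278) (.nb 9496 (.lf 56 404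
    227) (.na 18306 (.lf 64 404 198) (.nb 10045 (.lf 52 452 162) (.na 18855 (.lf 52 396
    139) (.nb 10320 (.lf 44 372 112) (.na 19130 (.lf 48 460 99) (.nb 10457 (.lf 44 468 81)
    (.lf 40 376 69)))))))))) (.nb 12792 (.na 17208 (.lf 100 300 226) (.na 18307 (.lf 72 380
    161) (.nb 11144 (.na 18856 (.lf 56 392 113) (.na 19131 (.lf 48 344 79) (.lf 40 76 51)))
    (.lf 60 100 73)))) (.lf 124 144 153))))

set_option maxRecDepth 10000 in
lemma tree_ok : chk tree 0 30001 0 30001 = true := by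
  decide +kernel

end TES

namespace TES
set_option linter.unusedSectionVars false

variable {V : Type*} [Fintype V] [DecidableEq V]

def nn (z z' c : ℕ) (x : ℕ) : ℕ := if x = 0 then z else if x = 16 then z' else c

lemma Lc_nn (z z' c j : ℕ) (hj : j < 16) : Lc (nn z z' c) j = fL z c j := by
  unfold Lc fL
  induction j with
  | zero => simp [nn]
  | succ j ih =>
    rw [Finset.sum_range_succ, ih (by omega)]
    have : nn z z' c (j + 1) = c := by
      unfold nn
      rw [if_neg (by omega), if_neg (by omega)]
    rw [this]; ring

lemma fsL_eq (z c j : ℕ) : fsL z c j = ∑ i ∈ Finset.range j, fL z c i := by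
  induction j with
  | zero => rfl
  | succ j ih => rw [Finset.sum_range_succ, ← ih]; rfl

lemma fsQ_eq (z c j : ℕ) : fsQ z c j = ∑ i ∈ Finset.range j, fL z c i ^ 2 := by
  induction j with
  | zero => rfl
  | succ j ih => rw [Finset.sum_range_succ, ← ih]; rfl

lemma conv_nn (z z' c j : ℕ) (hj : j < 16) (G : ℕ → ℕ) :
    ∑ x ∈ Finset.range (j + 1), nn z z' c x * G (j - x) = z * G j + c * ∑ i ∈ Finset.range j, G i := by
  rw [Finset.sum_range_succ', add_comm]
  congr 1
  rw [← Finset.sum_range_reflect, Finset.mul_sum]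
  apply Finset.sum_congr rfl
  intro x hx
  have hx := Finset.mem_range.1 hx
  have : nn z z' c (j - 1 - x + 1) = c := by
    unfold nn
    rw [if_neg (by omega), if_neg (by omega)]
  rw [this]
  congr 2
  omega

lemma Sc_nn (z z' c j : ℕ) (hj : j < 16) : Sc (nn z z' c) j = fS z c j := by
  unfold Sc fS
  rw [conv_nn z z' c j hj (fun i => Lc (nn z z' c) i), fsL_eq, Lc_nn _ _ _ _ hj]
  congr 2
  apply Finset.sum_congr rfl
  intro i hi
  have hi := Finset.mem_range.1 hi
  exact Lc_nn _ _ _ _ (by omega)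

lemma Qc_nn (z z' c j : ℕ) (hj : j < 16) : Qc (nn z z' c) j = fQ z c j := by
  unfold Qc fQ
  rw [conv_nn z z' c j hj (fun i => Lc (nn z z' c) i ^ 2), fsQ_eq, Lc_nn _ _ _ _ hj]
  congr 2
  apply Finset.sum_congr rfl
  intro i hi
  have hi := Finset.mem_range.1 hi
  rw [Lc_nn _ _ _ _ (by omega)]

lemma fv_eq (z c j : ℕ) : fv z c j = ∑ i ∈ Finset.range j, (15000 * fQ z c i - fS z c i ^ 2) := by
  induction j with
  | zero => rfl
  | succ j ih => rw [Finset.sum_range_succ, ← ih]; rfl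

lemma sum_vC_le (p : Fin 17 → ℚ) (z z' c : ℕ) (lev : Fin 17 → ℕ)
    (hp : ∀ x, p x = nn z z' c (lev x) / 15000)
    (hlev : ∀ G : ℕ → ℚ, ∑ x, G (lev x) = ∑ i ∈ Finset.range 17, G i) :
    ∑ j ∈ Finset.range 16, vC p lev j ≤ fv z c 16 / 15000 ^ 4 := by
  rw [fv_eq, Nat.cast_sum, Finset.sum_div]
  apply Finset.sum_le_sum
  intro j hj
  have hj := Finset.mem_range.1 hj
  rw [vC_eval p _ lev hp hlev j hj, Qc_nn _ _ _ _ hj, Sc_nn _ _ _ _ hj]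
  apply div_le_div_of_nonneg_right _ (by positivity)
  have : 15000 * fQ z c j ≤ (15000 * fQ z c j - fS z c j ^ 2) + fS z c j ^ 2 := by omega
  have h2 : ((15000 * fQ z c j : ℕ) : ℚ) ≤ ((15000 * fQ z c j - fS z c j ^ 2 : ℕ) : ℚ) + ((fS z c j ^ 2 : ℕ) : ℚ) := by
    exact_mod_cast this
  push_cast at h2
  linarith

lemma allOK_at (f : ℕ → Bool) (n : ℕ) (h : allOK f n = true) (j : ℕ) (hj : j < n) : f j = true := by
  induction n with
  | zero => omega
  | succ n ih =>
    simp only [allOK, Bool.and_eq_true] at h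
    rcases Nat.lt_succ_iff_lt_or_eq.1 hj with h1 | h1
    · exact ih h.2 h1
    · exact h1 ▸ h.1

lemma sideOK_at {z c x1 x2 y1 y2 e j : ℕ} (h : sideOK z c x1 x2 y1 y2 e j = true) :
    fS z c j ≤ 15000 * fL z c j ∧
    16 * (x1 + y2) * fS z c j + (10000 * (j + 1) + 16 * (68 + e)) * 15000 ^ 2 ≤
    16 * (x1 * 15000 * fL z c j + 30000 * fS z c j) ∧
    16 * (x2 * 15000 * fL z c j + 30000 * fS z c j) + 16 * (68 + e) * 15000 ^ 2 ≤
    16 * (x2 + y1) * fS z c j + (160000 + 10000 * j) * 15000 ^ 2 := by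
  simp only [sideOK, Bool.and_eq_true] at h
  exact ⟨Nat.le_of_ble_eq_true h.1, Nat.le_of_ble_eq_true h.2.1, Nat.le_of_ble_eq_true h.2.2⟩

lemma side_count (E : Finset (V × V)) (U0 U1 : Finset V) (hU : Disjoint U0 U1) (l : V → ℕ)
    (h0 : ∀ v ∈ U0, l v = 0) (h1 : ∀ v ∈ U1, l v = 16) (j : ℕ) (hj : j < 16) :
    (∑ v ∈ (U0 ∪ U1)ᶜ with l v ≤ j, jn E U0 v) +
      ((E.filter (fun e => e.1 ∈ (U0 ∪ U1)ᶜ ∧ e.2 ∈ (U0 ∪ U1)ᶜ)).filter (fun e => l e.1 + l e.2 ≤ j)).card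
      ≤ lc E l j ∧
    lc E l j ≤ (∑ v ∈ (U0 ∪ U1)ᶜ with l v ≤ j, jn E U0 v) +
      ((E.filter (fun e => e.1 ∈ (U0 ∪ U1)ᶜ ∧ e.2 ∈ (U0 ∪ U1)ᶜ)).filter (fun e => l e.1 + l e.2 ≤ j)).card
      + ins E (U0 ∪ U1) := by
  have hd : Disjoint U0 ((U0 ∪ U1)ᶜ.filter (fun v => l v ≤ j)) := by
    rw [Finset.disjoint_left]
    intro v hv hv'
    simp [hv] at hv'
  rw [sum_jn E _ _ hd]
  unfold lc ins
  constructor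
  · rw [← Finset.card_union_of_disjoint]
    · apply Finset.card_le_card
      intro e he
      simp only [Finset.mem_union, Finset.mem_filter, Finset.mem_compl] at he ⊢
      rcases he with ⟨he, h | h⟩ | ⟨he, h⟩
      · exact ⟨he, by rw [h0 _ h.2]; exact h.1.2⟩
      · exact ⟨he, by rw [h0 _ h.2]; simpa using h.1.2⟩
      · exact ⟨he.1, h⟩
    · rw [Finset.disjoint_left]
      intro e he he'
      simp only [Finset.mem_union, Finset.mem_filter, Finset.mem_compl] at he he'
      tauto
  · refine (Finset.card_le_card (t := _ ∪ _ ∪ _) ?_).trans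
      ((Finset.card_union_le _ _).trans (Nat.add_le_add_right (Finset.card_union_le _ _) _))
    intro e he
    simp only [Finset.mem_union, Finset.mem_filter, Finset.mem_compl] at he ⊢
    have a1 := h1 e.1
    have a2 := h1 e.2
    have b1 : e.1 ∉ U1 := fun h => by have := a1 h; omega
    have b2 : e.2 ∉ U1 := fun h => by have := a2 h; omega
    have c1 : l e.1 ≤ j := by omega
    have c2 : l e.2 ≤ j := by omega
    have c3 := he.2
    obtain ⟨he, -⟩ := he
    clear a1 a2
    by_cases d1 : e.1 ∈ U0 <;> by_cases d2 : e.2 ∈ U0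
    · right; exact ⟨he, Or.inl d1, Or.inl d2⟩
    · left; left; exact ⟨he, Or.inr ⟨⟨by simp [d2, b2], c2⟩, d1⟩⟩
    · left; left; exact ⟨he, Or.inl ⟨⟨by simp [d1, b1], c1⟩, d2⟩⟩
    · left; right; exact ⟨⟨he, by simp [d1, b1], by simp [d2, b2]⟩, by assumption⟩

end TES

namespace TES
set_option linter.unusedSectionVars false

variable {V : Type*} [Fintype V] [DecidableEq V]

lemma num_low (k A B C H L S x1 y2 e j lcv ac cc : ℚ) (hk : 30000 ≤ k)
    (hA : x1 * k ≤ 10000 * A) (hB : 10000 * B ≤ y2 * k) (hC : A + B + C + H = 3 * k + 1)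
    (hH0 : 0 ≤ H) (hH : 10000 * H ≤ 22 * k) (hS0 : 0 ≤ S) (hS : S ≤ 15000 * L) (hL : L ≤ 15000)
    (h1 : |ac - A * (L / 15000)| < 45 * k / 10000) (h2 : |cc - C * (S / 15000 ^ 2)| < e * k / 10000)
    (h : 16 * (x1 + y2) * S + (10000 * (j + 1) + 16 * (68 + e)) * 15000 ^ 2 ≤
      16 * (x1 * 15000 * L + 30000 * S)) (hl : ac + cc ≤ lcv) :
    (j + 1) * k + 48 ≤ 16 * lcv := by
  obtain ⟨s, rfl⟩ : ∃ s, S = s * 15000 ^ 2 := ⟨S / 15000 ^ 2, by field_simp⟩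
  obtain ⟨l, rfl⟩ : ∃ l, L = l * 15000 := ⟨L / 15000, by field_simp⟩
  rw [mul_div_cancel_right₀ _ (by norm_num)] at h1 h2
  have s0 : 0 ≤ s := by linarith
  have sl : s ≤ l := by linarith
  have l1 : l ≤ 1 := by linarith
  have h' : 16 * (x1 + y2) * s + (10000 * (j + 1) + 16 * (68 + e)) ≤ 16 * (x1 * l + 30000 * s) := by linarith
  have t1 : 0 ≤ (10000 * A - x1 * k) * (l - s) := mul_nonneg (by linarith) (by linarith)
  have t2 : 0 ≤ (y2 * k - 10000 * B) * s := mul_nonneg (by linarith) s0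
  have t3 : 0 ≤ H * (1 - s) := mul_nonneg hH0 (by linarith)
  have t4 := mul_le_mul_of_nonneg_right h' (show (0:ℚ) ≤ k by linarith)
  have t5 := (abs_lt.1 h1).1
  have t6 := (abs_lt.1 h2).1
  obtain rfl : C = 3 * k + 1 - A - B - H := by linarith
  nlinarith

lemma num_up (k A B C H L S x2 y1 e j lcv ac cc : ℚ) (hk : 30000 ≤ k)
    (hA : 10000 * A ≤ x2 * k) (hB : y1 * k ≤ 10000 * B) (hC : A + B + C + H = 3 * k + 1)
    (hH0 : 0 ≤ H) (hH : 10000 * H ≤ 22 * k) (hS0 : 0 ≤ S) (hS : S ≤ 15000 * L) (hL : L ≤ 15000)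
    (h1 : |ac - A * (L / 15000)| < 45 * k / 10000) (h2 : |cc - C * (S / 15000 ^ 2)| < e * k / 10000)
    (h : 16 * (x2 * 15000 * L + 30000 * S) + 16 * (68 + e) * 15000 ^ 2 ≤
    16 * (x2 + y1) * S + (160000 + 10000 * j) * 15000 ^ 2) (hl : lcv ≤ ac + cc + H) :
    16 * lcv + 16 ≤ 16 * k + j * k := by
  obtain ⟨s, rfl⟩ : ∃ s, S = s * 15000 ^ 2 := ⟨S / 15000 ^ 2, by field_simp⟩
  obtain ⟨l, rfl⟩ : ∃ l, L = l * 15000 := ⟨L / 15000, by field_simp⟩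
  rw [mul_div_cancel_right₀ _ (by norm_num)] at h1 h2
  have s0 : 0 ≤ s := by linarith
  have sl : s ≤ l := by linarith
  have l1 : l ≤ 1 := by linarith
  have h' : 16 * (x2 * l + 30000 * s) + 16 * (68 + e) ≤
    16 * (x2 + y1) * s + (160000 + 10000 * j) := by linarith
  have t1 : 0 ≤ (x2 * k - 10000 * A) * (l - s) := mul_nonneg (by linarith) (by linarith)
  have t2 : 0 ≤ (10000 * B - y1 * k) * s := mul_nonneg (by linarith) s0
  have t3 : 0 ≤ H * s := mul_nonneg hH0 (by linarith)
  have t4 := mul_le_mul_of_nonneg_right h' (show (0:ℚ) ≤ k by linarith)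
  have t5 := (abs_lt.1 h1).2
  have t6 := (abs_lt.1 h2).2
  obtain rfl : C = 3 * k + 1 - A - B - H := by linarith
  nlinarith

lemma sum_ind (Z : Finset V) (a : V → ℚ) (P : V → Prop) [DecidablePred P] (m : ℚ) :
    ∑ v ∈ Z, a v * ((if P v then 1 else 0) - m) = (∑ v ∈ Z with P v, a v) - (∑ v ∈ Z, a v) * m := by
  rw [Finset.sum_filter, Finset.sum_mul, ← Finset.sum_sub_distrib]
  apply Finset.sum_congr rfl
  intro v _
  split_ifs <;> ring

lemma sum_ind' {W : Type*} (Z : Finset W) (P : W → Prop) [DecidablePred P] (m : ℚ) :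
    ∑ v ∈ Z, ((if P v then 1 else 0) - m) = ((Z.filter P).card : ℚ) - Z.card * m := by
  rw [Finset.sum_sub_distrib, Finset.sum_boole, Finset.sum_const, nsmul_eq_mul]

lemma jn_le_card (E : Finset (V × V)) (hs : ∀ e ∈ E, (e.2, e.1) ∉ E) (S : Finset V) (v : V) :
    jn E S v ≤ S.card := by
  induction S using Finset.induction_on with
  | empty => simp [jn]
  | insert a S ha ih =>
    rw [Finset.card_insert_of_notMem ha, Finset.insert_eq]
    have := jn_union_le E {a} S v
    have := jn_singleton_le E hs a v
    omega

lemma sum_jn_swap (E : Finset (V × V)) (S Z : Finset V) (h : Disjoint S Z) :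
    ∑ v ∈ Z, jn E S v = ∑ v ∈ S, jn E Z v := by
  rw [sum_jn E S Z h, sum_jn E Z S h.symm]
  congr 1
  ext e
  simp only [Finset.mem_filter]
  tauto

lemma budget (k AB C D e N sv fvs Q : ℚ) (hk : 23333333333 ≤ k) (hAB0 : 0 ≤ AB) (hC0 : 0 ≤ C) 
    (hABC : AB + C ≤ 3 * k + 1) (hQ : Q ≤ 10020 * AB)
    (hD0 : 0 ≤ D) (hD : 10000 * D ≤ 3 * k) (he : 50 ≤ e) (hN : 10000 * C ≤ N * k)
    (hsv0 : 0 ≤ fvs) (hsv : sv ≤ fvs / 15000 ^ 4) (hb : 600 * fvs * N ≤ 74 * e ^ 2 * 15000 ^ 4) :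
    4 * Q / (45 * k / 10000) ^ 2 + C * (32 + 2 * D * sv) / (e * k / 10000) ^ 2 < 1 := by
  have hk0 : 0 < k := by linarith
  have he0 : 0 < e := by linarith
  have t1 : 4 * Q / (45 * k / 10000) ^ 2 ≤ 0.255 := by
    rw [div_le_iff₀ (by positivity)]
    nlinarith
  have t2 : C * 32 / (e * k / 10000) ^ 2 ≤ 0.001 := by
    rw [div_le_iff₀ (by positivity)]
    have : 2500 * k ^ 2 ≤ (e * k) ^ 2 := by
      rw [mul_pow]; apply mul_le_mul_of_nonneg_right _ (by positivity); nlinarith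
    nlinarith
  have t3 : C * (2 * D * sv) / (e * k / 10000) ^ 2 ≤ 0.74 := by
    rw [div_le_iff₀ (by positivity)]
    have a1 : C * (2 * D * sv) ≤ C * (2 * D * (fvs / 15000 ^ 4)) := by gcongr
    have a2 : C * (2 * D * (fvs / 15000 ^ 4)) ≤ (N * k / 10000) * (2 * (3 * k / 10000) * (fvs / 15000 ^ 4)) := by
      have : C ≤ N * k / 10000 := by linarith
      have : D ≤ 3 * k / 10000 := by linarith
      gcongr
      linarith
    have a3 : (N * k / 10000) * (2 * (3 * k / 10000) * (fvs / 15000 ^ 4)) = (600 * fvs * N) / 15000 ^ 4 * (k ^ 2 / 10 ^ 10) := by ring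
    have a4 : (600 * fvs * N) / 15000 ^ 4 ≤ 74 * e ^ 2 := by
      rw [div_le_iff₀ (by positivity)]; exact hb
    have a5 := mul_le_mul_of_nonneg_right a4 (show 0 ≤ k ^ 2 / 10 ^ 10 by positivity)
    calc _ ≤ _ := a1.trans (a2.trans (a3.le.trans a5))
      _ = _ := by ring
  have : C * (32 + 2 * D * sv) / (e * k / 10000) ^ 2 = C * 32 / (e * k / 10000) ^ 2 + C * (2 * D * sv) / (e * k / 10000) ^ 2 := by ring
  rw [this]
  norm_num at t1 t2 t3 ⊢
  linarith

end TES

namespace TES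
set_option linter.unusedSectionVars false

variable {V : Type*} [Fintype V] [DecidableEq V]

lemma side_final (E : Finset (V × V)) (U0 U1 : Finset V) (l : V → ℕ)
    (h0 : ∀ v ∈ U0, l v = 0) (h1 : ∀ v ∈ U1, l v = 16) (hU : Disjoint U0 U1) (k z c x1 x2 y1 y2 e j : ℕ)
    (hk : 30000 ≤ k) (hj : j < 16)
    (hx1 : x1 * k ≤ 10000 * ∑ v ∈ (U0 ∪ U1)ᶜ, jn E U0 v)
    (hx2 : 10000 * ∑ v ∈ (U0 ∪ U1)ᶜ, jn E U0 v ≤ x2 * k)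
    (B : ℕ) (hy1 : y1 * k ≤ 10000 * B) (hy2 : 10000 * B ≤ y2 * k)
    (hC : (∑ v ∈ (U0 ∪ U1)ᶜ, jn E U0 v) + B +
      (E.filter (fun e => e.1 ∈ (U0 ∪ U1)ᶜ ∧ e.2 ∈ (U0 ∪ U1)ᶜ)).card + ins E (U0 ∪ U1) = 3 * k + 1)
    (hH : 10000 * ins E (U0 ∪ U1) ≤ 22 * k) (hz : z + 15 * c ≤ 15000)
    (hok : sideOK z c x1 x2 y1 y2 e j = true)
    (m1 m2 : ℚ) (hm1 : m1 = fL z c j / 15000) (hm2 : m2 = fS z c j / 15000 ^ 2)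
    (r1 : |∑ v ∈ (U0 ∪ U1)ᶜ, (jn E U0 v : ℚ) * ((if l v ≤ j then 1 else 0) - m1)| < 45 * k / 10000)
    (r2 : |∑ e ∈ E.filter (fun e => e.1 ∈ (U0 ∪ U1)ᶜ ∧ e.2 ∈ (U0 ∪ U1)ᶜ),
      ((if l e.1 + l e.2 ≤ j then 1 else 0) - m2)| < e * k / 10000) :
    (j + 1) * k + 48 ≤ 16 * lc E l j ∧ 16 * lc E l j + 16 ≤ 16 * k + j * k := by
  obtain ⟨q1, q2, q3⟩ := sideOK_at hok
  have sc := side_count E U0 U1 hU l h0 h1 j hj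
  rw [sum_ind, hm1] at r1
  rw [sum_ind', hm2] at r2
  have hL : fL z c j ≤ 15000 := by
    unfold fL
    have : c * j ≤ c * 15 := Nat.mul_le_mul_left c (by omega)
    omega
  generalize hF : (E.filter (fun e => e.1 ∈ (U0 ∪ U1)ᶜ ∧ e.2 ∈ (U0 ∪ U1)ᶜ)) = F at *
  generalize hA : ∑ v ∈ (U0 ∪ U1)ᶜ, jn E U0 v = A at *
  generalize hac : (∑ v ∈ (U0 ∪ U1)ᶜ with l v ≤ j, jn E U0 v) = ac at *
  generalize hcc : (F.filter (fun e => l e.1 + l e.2 ≤ j)).card = cc at *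
  generalize ins E (U0 ∪ U1) = H at *
  rw [← Nat.cast_sum, ← Nat.cast_sum, hac, hA] at r1
  have hk' : (30000 : ℚ) ≤ k := by exact_mod_cast hk
  have hC' : (A : ℚ) + B + F.card + H = 3 * k + 1 := by exact_mod_cast hC
  have hH' : 10000 * (H : ℚ) ≤ 22 * k := by exact_mod_cast hH
  have hS' : (fS z c j : ℚ) ≤ 15000 * fL z c j := by exact_mod_cast q1
  have hL' : (fL z c j : ℚ) ≤ 15000 := by exact_mod_cast hL
  constructor
  · have := num_low k A B F.card H (fL z c j) (fS z c j) x1 y2 e j (lc E l j) ac cc hk'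
      (by exact_mod_cast hx1) (by exact_mod_cast hy2) hC' (Nat.cast_nonneg _) hH' (Nat.cast_nonneg _) hS' hL' r1 r2
      (by exact_mod_cast q2) (by exact_mod_cast sc.1)
    exact_mod_cast this
  · have := num_up k A B F.card H (fL z c j) (fS z c j) x2 y1 e j (lc E l j) ac cc hk'
      (by exact_mod_cast hx2) (by exact_mod_cast hy1) hC' (Nat.cast_nonneg _) hH' (Nat.cast_nonneg _) hS' hL' r1 r2
      (by exact_mod_cast q3) (by exact_mod_cast sc.2)
    exact_mod_cast this

lemma sum_sq_le (Z : Finset V) (a : V → ℕ) (M : ℕ) (h : ∀ v, a v ≤ M) :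
    ∑ v ∈ Z, (a v : ℚ) ^ 2 ≤ M * ∑ v ∈ Z, (a v : ℚ) := by
  rw [Finset.mul_sum]
  apply Finset.sum_le_sum
  intro v _
  rw [sq]
  have : (a v : ℚ) ≤ M := by exact_mod_cast h v
  gcongr

lemma box_good (E : Finset (V × V)) (hloop : ∀ e ∈ E, e.1 ≠ e.2) (hs : ∀ e ∈ E, (e.2, e.1) ∉ E)
    (k : ℕ) (hk : 23333333333 ≤ k) (hE : E.card = 3 * k + 1) (U0 U1 : Finset V) (hU : Disjoint U0 U1)
    (hUc : (U0 ∪ U1).card ≤ 10020) (hdeg : ∀ v, v ∉ U0 ∪ U1 → 10000 * jn E Finset.univ v ≤ 3 * k)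
    (p q e a1 a2 b1 b2 : ℕ)
    (ha1 : a1 * k ≤ 10000 * ∑ v ∈ (U0 ∪ U1)ᶜ, jn E U0 v)
    (ha2 : 10000 * ∑ v ∈ (U0 ∪ U1)ᶜ, jn E U0 v ≤ a2 * k)
    (hb1 : b1 * k ≤ 10000 * ∑ v ∈ (U0 ∪ U1)ᶜ, jn E U1 v)
    (hb2 : 10000 * ∑ v ∈ (U0 ∪ U1)ᶜ, jn E U1 v ≤ b2 * k)
    (hbox : boxOK p q e a1 a2 b1 b2 = true) : ∃ w, Good E k w := by
  simp only [boxOK, Bool.and_eq_true] at hbox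
  obtain ⟨g1, g2, g3, g4, g5⟩ := hbox
  replace g1 := Nat.le_of_ble_eq_true g1
  replace g2 := Nat.le_of_ble_eq_true g2
  replace g3 := Nat.le_of_ble_eq_true g3
  set c := 1000 - p - q with hc
  have hpqc : p + q + c = 1000 := by omega
  clear_value c
  set F := E.filter (fun e => e.1 ∈ (U0 ∪ U1)ᶜ ∧ e.2 ∈ (U0 ∪ U1)ᶜ) with hF
  have hFE : F ⊆ E := Finset.filter_subset _ _
  -- counting
  have hAd : Disjoint U0 (U0 ∪ U1)ᶜ :=
    Finset.disjoint_of_subset_left Finset.subset_union_left disjoint_compl_right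
  have hBd : Disjoint U1 (U0 ∪ U1)ᶜ :=
    Finset.disjoint_of_subset_left Finset.subset_union_right disjoint_compl_right
  have hC : (∑ v ∈ (U0 ∪ U1)ᶜ, jn E U0 v) + (∑ v ∈ (U0 ∪ U1)ᶜ, jn E U1 v) + F.card + ins E (U0 ∪ U1)
      = 3 * k + 1 := by
    have h3 := split3 E ∅ (U0 ∪ U1) (Finset.disjoint_empty_left _)
    rw [Finset.empty_union, Finset.compl_empty, ins_univ, hE, Finset.sum_union hU,
      ← sum_jn_swap E _ _ hAd, ← sum_jn_swap E _ _ hBd] at h3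
    rw [← h3]
    have : ins E (U0 ∪ U1)ᶜ = F.card := rfl
    rw [this]; ring
  have hH : 10000 * ins E (U0 ∪ U1) ≤ 22 * k := by
    have h1 := sum_jn_self E hloop (U0 ∪ U1)
    have h2 : ∑ v ∈ U0 ∪ U1, jn E (U0 ∪ U1) v ≤ (U0 ∪ U1).card * 10020 := by
      apply Finset.sum_le_card_nsmul
      intro v _
      exact (jn_le_card E hs _ v).trans hUc
    have h3 : (U0 ∪ U1).card * 10020 ≤ 10020 * 10020 := Nat.mul_le_mul_right _ hUc
    omega
  -- distribution
  set pr : Fin 17 → ℚ := fun x => nn (15 * p) (15 * q) c (x : ℕ) / 15000 with hpr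
  have hpr' : ∀ x : Fin 17, pr x = nn (15 * q) (15 * p) c (16 - (x : ℕ)) / 15000 := by
    intro x
    have : nn (15 * p) (15 * q) c (x : ℕ) = nn (15 * q) (15 * p) c (16 - (x : ℕ)) := by
      unfold nn
      have := x.2
      split_ifs <;> first | rfl | omega
    simp only [hpr, this]
  have hpr1 : ∑ x, pr x = 1 := by
    rw [hpr, hlev_id (fun i => (nn (15 * p) (15 * q) c i : ℚ) / 15000), ← Finset.sum_div]
    have : ∑ i ∈ Finset.range 17, nn (15 * p) (15 * q) c i = 15000 := by
      simp only [Finset.sum_range_succ, Finset.sum_range_zero, nn]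
      norm_num
      omega
    rw [← Nat.cast_sum, this]; norm_num
  have hk0 : (0 : ℚ) < k := by exact_mod_cast (show 0 < k by omega)
  have he0 : (0 : ℚ) < e := by exact_mod_cast (show 0 < e by omega)
  have hD : ∀ v ∈ (U0 ∪ U1)ᶜ, (F.filter (fun e' => e'.1 = v ∨ e'.2 = v)).card ≤ 3 * k / 10000 := by
    intro v hv
    have h1 := hdeg v (Finset.mem_compl.1 hv)
    have h2 : (F.filter (fun e' => e'.1 = v ∨ e'.2 = v)).card ≤ jn E Finset.univ v := by
      unfold jn
      apply Finset.card_le_card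
      intro e' he'
      simp only [Finset.mem_filter, Finset.mem_univ, and_true] at he' ⊢
      exact ⟨hFE he'.1, he'.2⟩
    omega
  obtain ⟨f, hf⟩ := rand_core pr (fun x => by positivity) hpr1 (U0 ∪ U1)ᶜ
    (fun v => (jn E U0 v : ℚ)) (fun v => (jn E U1 v : ℚ)) F (fun e he => hloop e (hFE he))
    (fun e he h => hs e (hFE he) (hFE h)) (3 * k / 10000)
    (fun e he => ⟨hD _ (Finset.mem_filter.1 he).2.1, hD _ (Finset.mem_filter.1 he).2.2⟩)
    (fun x => (x : ℕ)) (fun x => 16 - (x : ℕ)) (45 * k / 10000) (e * k / 10000)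
    (by positivity) (by positivity) (by
      have hU0 : U0.card ≤ 10020 := (Finset.card_le_card Finset.subset_union_left).trans hUc
      have hU1 : U1.card ≤ 10020 := (Finset.card_le_card Finset.subset_union_right).trans hUc
      have s0 := sum_sq_le (U0 ∪ U1)ᶜ (jn E U0) 10020 (fun v => (jn_le_card E hs _ v).trans hU0)
      have s1 := sum_sq_le (U0 ∪ U1)ᶜ (jn E U1) 10020 (fun v => (jn_le_card E hs _ v).trans hU1)
      have v0 := sum_vC_le pr (15 * p) (15 * q) c (fun x => (x : ℕ)) (fun x => rfl) hlev_id
      have v1 := sum_vC_le pr (15 * q) (15 * p) c (fun x => 16 - (x : ℕ)) hpr' hlev_rev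
      rw [← Nat.cast_sum] at s0 s1
      generalize ∑ v ∈ (U0 ∪ U1)ᶜ, jn E U0 v = A at *
      generalize ∑ v ∈ (U0 ∪ U1)ᶜ, jn E U1 v = B at *
      have hC' : (A : ℚ) + B + F.card + (ins E (U0 ∪ U1) : ℚ) = 3 * k + 1 := by exact_mod_cast hC
      have hi : (0 : ℚ) ≤ ins E (U0 ∪ U1) := Nat.cast_nonneg _
      have ha1' : (a1 : ℚ) * k ≤ 10000 * A := by exact_mod_cast ha1
      have hb1' : (b1 : ℚ) * k ≤ 10000 * B := by exact_mod_cast hb1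
      have hk' : (23333333333 : ℚ) ≤ k := by exact_mod_cast hk
      have hN : (30001 : ℚ) ≤ ((30000 - a1 - b1 + 1 : ℕ) : ℚ) + a1 + b1 := by
        exact_mod_cast (show 30001 ≤ (30000 - a1 - b1 + 1) + a1 + b1 by omega)
      have hA0 : (0 : ℚ) ≤ A := Nat.cast_nonneg _
      have hB0 : (0 : ℚ) ≤ B := Nat.cast_nonneg _
      have hD3 : (10000 : ℚ) * ((3 * k / 10000 : ℕ) : ℚ) ≤ 3 * k := by
        exact_mod_cast (show 10000 * (3 * k / 10000) ≤ 3 * k by omega)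
      have hN' := mul_le_mul_of_nonneg_right hN hk0.le
      apply budget k (A + B) F.card ((3 * k / 10000 : ℕ) : ℚ) e ((30000 - a1 - b1 + 1 : ℕ) : ℚ) _
        (fv (15 * p) c 16 + fv (15 * q) c 16 : ℕ) _ hk' (by positivity) (Nat.cast_nonneg _)
        (by linarith) (by push_cast at s0 s1; linarith) (Nat.cast_nonneg _) hD3 (by exact_mod_cast g2)
        (by linarith) (Nat.cast_nonneg _) (by
          rw [Finset.sum_add_distrib, Nat.cast_add, add_div]
          exact add_le_add v0 v1) (by exact_mod_cast g3))
  set l : V → ℕ := fun v => if v ∈ U0 then 0 else if v ∈ U1 then 16 else (f v : ℕ) with hl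
  have l_lf : ∀ v ∈ (U0 ∪ U1)ᶜ, l v = (f v : ℕ) := by
    intro v hv
    simp only [Finset.mem_compl, Finset.mem_union, not_or] at hv
    simp [hl, hv.1, hv.2]
  have l0 : ∀ v ∈ U0, l v = 0 := fun v hv => by simp [hl, hv]
  have l1 : ∀ v ∈ U1, l v = 16 := fun v hv => by
    have : v ∉ U0 := fun h => Finset.disjoint_left.1 hU h hv
    simp [hl, hv, this]
  have hl16 : ∀ v, l v ≤ 16 := by
    intro v
    have := (f v).2
    simp only [hl]
    split_ifs <;> omega
  have S0 : ∀ j < 16, (j + 1) * k + 48 ≤ 16 * lc E l j ∧ 16 * lc E l j + 16 ≤ 16 * k + j * k := by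
    intro j hj
    obtain ⟨r1, -, r3, -⟩ := hf j hj
    refine side_final E U0 U1 l l0 l1 hU k (15 * p) c a1 a2 b1 b2 e j (by omega) hj ha1 ha2 _ hb1 hb2 hC hH (by omega)
      (allOK_at _ _ g4 j hj) (mA pr (fun x => (x : ℕ)) j) (mC pr (fun x => (x : ℕ)) j) ?_ ?_ ?_ ?_
    · rw [mA_eval pr _ _ (fun x => rfl) hlev_id j hj, Lc_nn _ _ _ _ hj]
    · rw [mC_eval pr _ _ (fun x => rfl) hlev_id j hj, Sc_nn _ _ _ _ hj]
    · convert r1 using 2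
      apply Finset.sum_congr rfl
      intro v hv
      rw [l_lf v hv]
    · convert r3 using 2
      apply Finset.sum_congr rfl
      intro v hv
      rw [l_lf _ (Finset.mem_filter.1 hv).2.1, l_lf _ (Finset.mem_filter.1 hv).2.2]
  have S1 : ∀ j < 16, (j + 1) * k + 48 ≤ 16 * lc E (fun v => 16 - l v) j ∧
      16 * lc E (fun v => 16 - l v) j + 16 ≤ 16 * k + j * k := by
    intro j hj
    obtain ⟨-, r1, -, r3⟩ := hf j hj
    rw [hF] at r3 hC
    rw [Finset.union_comm U0 U1] at r1 r3 ha1 ha2 hb1 hb2 hC hH l_lf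
    refine side_final E U1 U0 (fun v => 16 - l v) (fun v hv => by simp [l1 v hv]) (fun v hv => by simp [l0 v hv])
      hU.symm k (15 * q) c b1 b2 a1 a2 e j (by omega) hj hb1 hb2 _ ha1 ha2 (by rw [← hC]; ring) hH (by omega)
      (allOK_at _ _ g5 j hj) (mA pr (fun x => 16 - (x : ℕ)) j) (mC pr (fun x => 16 - (x : ℕ)) j) ?_ ?_ ?_ ?_
    · rw [mA_eval pr _ _ hpr' hlev_rev j hj, Lc_nn _ _ _ _ hj]
    · rw [mC_eval pr _ _ hpr' hlev_rev j hj, Sc_nn _ _ _ _ hj]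
    · convert r1 using 2
      apply Finset.sum_congr rfl
      intro v hv
      rw [l_lf v hv]
    · convert r3 using 2
      apply Finset.sum_congr rfl
      intro v hv
      rw [l_lf _ (Finset.mem_filter.1 hv).2.1, l_lf _ (Finset.mem_filter.1 hv).2.2]
  exact level_good E k hE l hl16 (fun j hj => (S0 j hj).1) (fun j hj => (S0 j hj).2)
    (fun j hj => (S1 j hj).1) (fun j hj => (S1 j hj).2)

end TES

namespace TES
set_option linter.unusedSectionVars false

variable {V : Type*} [Fintype V] [DecidableEq V]

lemma le_min_mul {X x y k : ℕ} (h1 : X ≤ x * k) (h2 : X ≤ y * k) : X ≤ min x y * k := by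
  rcases min_choice x y with h | h <;> rw [h] <;> assumption

lemma max_mul_le' {X x y k : ℕ} (h1 : x * k ≤ X) (h2 : y * k ≤ X) : max x y * k ≤ X := by
  rcases max_choice x y with h | h <;> rw [h] <;> assumption

lemma le_sub_mul {X x y k : ℕ} (h : X + y * k ≤ x * k) : X ≤ (x - y) * k := by
  rw [Nat.sub_mul]; omega

lemma sub_mul_le {X x y k : ℕ} (h : x * k ≤ X + y * k) : (x - y) * k ≤ X := by
  rw [Nat.sub_mul]; omega

lemma chk_sound (k A B : ℕ) (hk : 23333333333 ≤ k) (P : Prop) (hBA : B ≤ A) (hAB : A + B ≤ 3 * k + 1)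
    (hsp : 10000 * A ≤ 10000 * B + 8810 * k ∨ 2 * A ≤ 3 * k + 6)
    (hP : ∀ p q e a1 a2 b1 b2 : ℕ, a1 * k ≤ 10000 * A → 10000 * A ≤ a2 * k → b1 * k ≤ 10000 * B →
      10000 * B ≤ b2 * k → boxOK p q e a1 a2 b1 b2 = true → P) (t : Tr) :
    ∀ a1 a2 b1 b2 : ℕ, a1 * k ≤ 10000 * A → 10000 * A ≤ a2 * k → b1 * k ≤ 10000 * B →
      10000 * B ≤ b2 * k → chk t a1 a2 b1 b2 = true → P := by
  induction t with
  | lf p q e =>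
    intro a1 a2 b1 b2 h1 h2 h3 h4 h
    simp only [chk, leafOK] at h
    split_ifs at h with hc
    · have h5 : 15011 * k ≤ a1 * k := Nat.mul_le_mul_right _ hc
      have h6 : 10000 * A ≤ 10000 * B + 8810 * k := by omega
      refine hP _ _ _ _ _ _ _ (max_mul_le' h1 (by omega)) (le_min_mul (le_min_mul (le_min_mul h2 ?_) (by omega))
        (le_sub_mul (by omega))) (max_mul_le' h3 (sub_mul_le (by omega)))
        (le_min_mul (le_min_mul h4 (by omega)) (le_sub_mul (by omega))) h
      rw [add_mul]; omega
    · exact hP _ _ _ _ _ _ _ (max_mul_le' h1 (by omega)) (le_min_mul h2 (le_sub_mul (by omega))) h3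
        (le_min_mul (le_min_mul h4 (by omega)) (le_sub_mul (by omega))) h
  | na c l r ihl ihr =>
    intro a1 a2 b1 b2 h1 h2 h3 h4 h
    simp only [chk, Bool.and_eq_true] at h
    rcases le_total (10000 * A) (c * k) with h5 | h5
    · exact ihl _ _ _ _ h1 h5 h3 h4 h.1
    · exact ihr _ _ _ _ h5 h2 h3 h4 h.2
  | nb c l r ihl ihr =>
    intro a1 a2 b1 b2 h1 h2 h3 h4 h
    simp only [chk, Bool.and_eq_true] at h
    rcases le_total (10000 * B) (c * k) with h5 | h5
    · exact ihl _ _ _ _ h1 h2 h3 h5 h.1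
    · exact ihr _ _ _ _ h1 h2 h5 h4 h.2

lemma heavy_card (E : Finset (V × V)) (hloop : ∀ e ∈ E, e.1 ≠ e.2)
    (k : ℕ) (hk : 23333333333 ≤ k) (hE : E.card = 3 * k + 1) :
    (Finset.univ.filter (fun v => 3 * k < 10000 * jn E Finset.univ v)).card ≤ 10020 := by
  by_contra hcon
  push Not at hcon
  obtain ⟨T, hT, hTc⟩ := Finset.exists_subset_card_eq hcon.le
  have h1 : T.card * (3 * k / 10000) ≤ ∑ v ∈ T, jn E Finset.univ v := by
    rw [← smul_eq_mul]
    apply Finset.card_nsmul_le_sum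
    intro v hv
    have := (Finset.mem_filter.1 (hT hv)).2
    omega
  have h2 : ∑ v ∈ T, jn E Finset.univ v = ∑ v ∈ T, jn E T v + ∑ v ∈ T, jn E Tᶜ v := by
    rw [← Finset.sum_add_distrib]
    apply Finset.sum_congr rfl
    intro v _
    rw [← jn_univ_split E hloop T Tᶜ disjoint_compl_right, Finset.union_compl]
  have h3 := split3 E ∅ T (Finset.disjoint_empty_left _)
  rw [Finset.empty_union, Finset.compl_empty, ins_univ, hE] at h3
  have h4 := sum_jn_self E hloop T
  have h5 := ins_le_sq E T
  rw [hTc] at h1 h5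
  omega

lemma regimeG (E : Finset (V × V)) (hloop : ∀ e ∈ E, e.1 ≠ e.2) (hs : ∀ e ∈ E, (e.2, e.1) ∉ E)
    (k : ℕ) (hk : 23333333333 ≤ k) (hE : E.card = 3 * k + 1)
    (h1 : ∀ v, 2 * jn E Finset.univ v < 3 * k + 6)
    (h2 : (Finset.univ.filter (fun v => 22 * k ≤ 25 * jn E Finset.univ v)).card ≤ 2) : ∃ w, Good E k w := by
  set U := Finset.univ.filter (fun v => 3 * k < 10000 * jn E Finset.univ v) with hU
  have hUc := heavy_card E hloop k hk hE
  rw [← hU] at hUc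
  set Big := Finset.univ.filter (fun v => 22 * k ≤ 25 * jn E Finset.univ v) with hBig
  have hBU : Big ⊆ U := by
    intro v hv
    simp only [hBig, hU, Finset.mem_filter, Finset.mem_univ, true_and] at hv ⊢
    omega
  have hj : ∀ v, jn E Uᶜ v ≤ jn E Finset.univ v := fun v => jn_mono E (Finset.subset_univ _) v
  obtain ⟨S, T, hST, hd, hTS, hor⟩ := split_lemma (jn E Uᶜ) (22 * k / 25) ((3 * k + 6) / 2) Big (U \ Big) h2
    (fun v hv => (Finset.mem_sdiff.1 hv).2)
    (fun v _ => by have := h1 v; have := hj v; omega)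
    (fun v hv => by
      have := (Finset.mem_sdiff.1 hv).2
      simp only [hBig, Finset.mem_filter, Finset.mem_univ, true_and] at this
      have := hj v
      omega)
  rw [Finset.union_sdiff_of_subset hBU] at hST
  have hSd : Disjoint S Uᶜ := by
    rw [← hST]
    exact Finset.disjoint_of_subset_left Finset.subset_union_left disjoint_compl_right
  have hTd : Disjoint T Uᶜ := by
    rw [← hST]
    exact Finset.disjoint_of_subset_left Finset.subset_union_right disjoint_compl_right
  have h3 := split3 E ∅ U (Finset.disjoint_empty_left _)
  rw [Finset.empty_union, Finset.compl_empty, ins_univ, hE] at h3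
  have h4 : ∑ v ∈ U, jn E Uᶜ v = ∑ v ∈ S, jn E Uᶜ v + ∑ v ∈ T, jn E Uᶜ v := by
    conv_lhs => rw [← hST]
    rw [Finset.sum_union hd, hST]
  rw [← sum_jn_swap E _ _ hSd, ← sum_jn_swap E _ _ hTd] at hTS hor h4
  have hdeg : ∀ v, v ∉ S ∪ T → 10000 * jn E Finset.univ v ≤ 3 * k := by
    intro v hv
    rw [hST] at hv
    simp only [hU, Finset.mem_filter, Finset.mem_univ, true_and] at hv
    omega
  refine chk_sound k _ _ hk _ hTS (by omega) (by omega) ?_ tree 0 30001 0 30001 (by omega) (by omega) (by omega)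
    (by omega) tree_ok
  intro p q e a1 a2 b1 b2 x1 x2 x3 x4 hb
  rw [← hST] at x1 x2 x3 x4 hUc
  exact box_good E hloop hs k hk hE S T hd hUc hdeg p q e a1 a2 b1 b2 x1 x2 x3 x4 hb

/-- All regimes combined. -/
lemma exists_good (E : Finset (V × V)) (hloop : ∀ e ∈ E, e.1 ≠ e.2) (hs : ∀ e ∈ E, (e.2, e.1) ∉ E)
    (k : ℕ) (hk : 23333333333 ≤ k) (hE : E.card = 3 * k + 1) (hdeg : ∀ v, jn E Finset.univ v ≤ 2 * k + 1) :
    ∃ w, Good E k w := by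
  by_cases h1 : ∃ v, 3 * k + 6 ≤ 2 * jn E Finset.univ v
  · obtain ⟨v, hv⟩ := h1
    exact regimeS E hloop hs k (by omega) hE v hv (hdeg v)
  push Not at h1
  by_cases h2 : (Finset.univ.filter (fun v => 22 * k ≤ 25 * jn E Finset.univ v)).card ≤ 2
  · exact regimeG E hloop hs k hk hE h1 h2
  · obtain ⟨a, ha, b, hb, c, hc, hab, hac, hbc⟩ := Finset.two_lt_card.1 (not_le.1 h2)
    simp only [Finset.mem_filter, Finset.mem_univ, true_and] at ha hb hc
    exact regimeW E hloop hs k (by omega) hE a b c hab hac hbc ha hb hc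

end TES

namespace TES
set_option linter.unusedSectionVars false

variable {V : Type*} [Fintype V] [DecidableEq V]

lemma good_label (E : Finset (V × V)) (k : ℕ) (hE : E.card = 3 * k + 1) (w : V → ℕ) (hG : Good E k w) :
    ∃ g : V × V → ℕ, (∀ e ∈ E, g e ≤ k) ∧
      Set.InjOn (fun e : V × V => g e + w e.1 + w e.2) (E : Set (V × V)) := by
  obtain ⟨hw, hG⟩ := hG
  have hN : ∀ x, x ≤ 2 * k → x + 1 ≤ (E.filter (fun e => w e.1 + w e.2 ≤ x)).card ∧
      (E.filter (fun e => w e.1 + w e.2 ≤ x)).card ≤ x + k + 1 := by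
    intro x hx
    rcases Nat.lt_or_ge x k with h | h
    · exact (hG x h).1
    rcases Nat.lt_or_ge x (2 * k) with h' | h'
    · have h2 := (hG (2 * k - x - 1) (by omega)).2
      have h3 : (E.filter (fun e => (k - w e.1) + (k - w e.2) ≤ 2 * k - x - 1)) =
          E.filter (fun e => ¬ (w e.1 + w e.2 ≤ x)) := by
        apply Finset.filter_congr
        intro e _
        have := hw e.1
        have := hw e.2
        omega
      rw [h3] at h2
      have := Finset.card_filter_add_card_filter_not (s := E) (fun e => w e.1 + w e.2 ≤ x)
      omega
    · have h3 : E.filter (fun e => w e.1 + w e.2 ≤ x) = E := by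
        apply Finset.filter_true_of_mem
        intro e _
        have := hw e.1
        have := hw e.2
        omega
      rw [h3]; omega
  obtain ⟨r, hr, hrm⟩ := rank_exists (fun e : V × V => w e.1 + w e.2)
  set ρ : V × V → ℕ := fun e => (E.filter (fun e' => r e' < r e)).card with hρ
  have hmono : ∀ e ∈ E, ∀ e' ∈ E, r e < r e' → ρ e < ρ e' := by
    intro e he e' he' h
    apply Finset.card_lt_card
    rw [Finset.ssubset_iff_of_subset]
    · exact ⟨e, by simp [he, h], by simp⟩
    · intro x hx
      simp only [Finset.mem_filter] at hx ⊢
      exact ⟨hx.1, hx.2.trans h⟩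
  have hb : ∀ e ∈ E, w e.1 + w e.2 ≤ ρ e ∧ ρ e ≤ w e.1 + w e.2 + k := by
    intro e he
    have := hw e.1
    have := hw e.2
    constructor
    · rcases Nat.eq_zero_or_pos (w e.1 + w e.2) with h | h
      · omega
      · have h1 := (hN (w e.1 + w e.2 - 1) (by omega)).1
        have h2 : (E.filter (fun e' => w e'.1 + w e'.2 ≤ w e.1 + w e.2 - 1)).card ≤ ρ e := by
          apply Finset.card_le_card
          intro x hx
          simp only [Finset.mem_filter] at hx ⊢
          refine ⟨hx.1, ?_⟩
          by_contra hc
          rcases Nat.lt_or_ge (r e) (r x) with h3 | h3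
          · have := hrm e x h3
            omega
          · have : x = e := hr (by omega)
            rw [this] at hx
            omega
        omega
    · have h1 := (hN (w e.1 + w e.2) (by omega)).2
      have h2 : ρ e < (E.filter (fun e' => w e'.1 + w e'.2 ≤ w e.1 + w e.2)).card := by
        apply Finset.card_lt_card
        rw [Finset.ssubset_iff_of_subset]
        · exact ⟨e, by simp [he], by simp⟩
        · intro x hx
          simp only [Finset.mem_filter] at hx ⊢
          exact ⟨hx.1, hrm x e hx.2⟩
      omega
  refine ⟨fun e => ρ e - (w e.1 + w e.2), fun e he => by have := hb e he; simp only; omega, ?_⟩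
  intro e he e' he' h
  have h1 := hb e he
  have h2 := hb e' he'
  simp only at h
  have h3 : ρ e = ρ e' := by omega
  apply hr
  by_contra hne
  rcases Nat.lt_or_gt_of_ne hne with h4 | h4
  · have := hmono e he e' he' h4; omega
  · have := hmono e' he' e he h4; omega

lemma pad_label (E : Finset (V × V)) (hloop : ∀ e ∈ E, e.1 ≠ e.2) (hs : ∀ e ∈ E, (e.2, e.1) ∉ E)
    (k : ℕ) (hk : 23333333333 ≤ k) (hE : E.card ≤ 3 * k + 1) (hdeg : ∀ v, jn E Finset.univ v ≤ 2 * k + 1) :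
    ∃ (w : V → ℕ) (g : V × V → ℕ), (∀ v, w v ≤ k) ∧ (∀ e ∈ E, g e ≤ k) ∧
      Set.InjOn (fun e : V × V => g e + w e.1 + w e.2) (E : Set (V × V)) := by
  obtain ⟨t, ht⟩ : ∃ t, E.card + t = 3 * k + 1 := ⟨3 * k + 1 - E.card, by omega⟩
  let i1 : V × V → (V ⊕ (Fin t × Bool)) × (V ⊕ (Fin t × Bool)) := fun e => (Sum.inl e.1, Sum.inl e.2)
  let i2 : Fin t → (V ⊕ (Fin t × Bool)) × (V ⊕ (Fin t × Bool)) := fun i => (Sum.inr (i, false), Sum.inr (i, true))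
  have hi1 : Function.Injective i1 := by
    rintro ⟨a, b⟩ ⟨c, d⟩ h
    simpa [i1] using h
  have hi2 : Function.Injective i2 := by
    intro a b h
    simpa [i2] using h
  let E' : Finset ((V ⊕ (Fin t × Bool)) × (V ⊕ (Fin t × Bool))) := E.image i1 ∪ Finset.univ.image i2
  have hmem : ∀ e, e ∈ E' ↔ (∃ x ∈ E, i1 x = e) ∨ ∃ i, i2 i = e := by
    intro e
    simp [E']
  have hE' : E'.card = 3 * k + 1 := by
    rw [Finset.card_union_of_disjoint, Finset.card_image_of_injective _ hi1,
      Finset.card_image_of_injective _ hi2, Finset.card_univ, Fintype.card_fin, ht]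
    rw [Finset.disjoint_left]
    intro e he he'
    simp only [Finset.mem_image] at he he'
    obtain ⟨x, _, rfl⟩ := he
    obtain ⟨y, _, h⟩ := he'
    simp [i1, i2] at h
  have hl' : ∀ e ∈ E', e.1 ≠ e.2 := by
    intro e he
    rcases (hmem e).1 he with ⟨x, hx, rfl⟩ | ⟨i, rfl⟩
    · simpa [i1] using hloop x hx
    · simp [i2]
  have hs' : ∀ e ∈ E', (e.2, e.1) ∉ E' := by
    intro e he he'
    rcases (hmem e).1 he with ⟨x, hx, rfl⟩ | ⟨i, rfl⟩ <;> rcases (hmem _).1 he' with ⟨y, hy, h⟩ | ⟨j, h⟩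
    · have : y = (x.2, x.1) := by
        simp only [i1, Prod.mk.injEq, Sum.inl.injEq] at h
        exact Prod.ext h.1 h.2
      exact hs x hx (this ▸ hy)
    · simp [i1, i2] at h
    · simp [i1, i2] at h
    · simp [i2] at h
  have hd' : ∀ v, jn E' Finset.univ v ≤ 2 * k + 1 := by
    rintro (v | ⟨i, b⟩)
    · refine le_trans ?_ (hdeg v)
      unfold jn
      refine (Finset.card_le_card (t := Finset.image i1 _) ?_).trans Finset.card_image_le
      intro e he
      simp only [Finset.mem_filter, Finset.mem_univ, and_true, Finset.mem_image] at he ⊢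
      rcases (hmem e).1 he.1 with ⟨x, hx, rfl⟩ | ⟨i, rfl⟩
      · exact ⟨x, ⟨hx, by simpa [i1] using he.2⟩, rfl⟩
      · simp [i2] at he
    · have : jn E' Finset.univ (Sum.inr (i, b)) ≤ ({i2 i} : Finset ((V ⊕ (Fin t × Bool)) × (V ⊕ (Fin t × Bool)))).card := by
        unfold jn
        apply Finset.card_le_card
        intro e he
        simp only [Finset.mem_filter, Finset.mem_univ, and_true, Finset.mem_singleton] at he ⊢
        rcases (hmem e).1 he.1 with ⟨x, hx, rfl⟩ | ⟨j, rfl⟩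
        · simp [i1] at he
        · have h2 := he.2
          simp only [i2, Sum.inr.injEq, Prod.mk.injEq] at h2
          have : j = i := by tauto
          rw [this]
      rw [Finset.card_singleton] at this
      omega
  obtain ⟨w, hw⟩ := exists_good E' hl' hs' k hk hE' hd'
  obtain ⟨g, hg, hinj⟩ := good_label E' k hE' w hw
  refine ⟨fun v => w (Sum.inl v), fun e => g (i1 e), fun v => hw.1 _,
    fun e he => hg _ ((hmem _).2 (Or.inl ⟨e, he, rfl⟩)), ?_⟩
  intro e he e' he' h
  exact hi1 (hinj ((hmem _).2 (Or.inl ⟨e, he, rfl⟩)) ((hmem _).2 (Or.inl ⟨e', he', rfl⟩)) h)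

end TES

namespace TES
set_option linter.unusedSectionVars false

variable {V : Type*} [Fintype V] [DecidableEq V]

lemma upper (G : SimpleGraph V) [DecidableRel G.Adj] (k : ℕ) (hk : 23333333333 ≤ k)
    (hm : G.edgeFinset.card ≤ 3 * k + 1) (hd : ∀ v, G.degree v ≤ 2 * k + 1) :
    ∃ (wv : V → ℕ) (we : Sym2 V → ℕ), IsEdgeIrregularTotalWeighting G (k + 1) wv we := by
  classical
  let φ := Fintype.equivFin V
  set E : Finset (V × V) := Finset.univ.filter (fun e => G.Adj e.1 e.2 ∧ φ e.1 < φ e.2) with hE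
  have hmem : ∀ e, e ∈ E ↔ G.Adj e.1 e.2 ∧ φ e.1 < φ e.2 := by intro e; simp [hE]
  have hinj : ∀ e ∈ E, ∀ e' ∈ E, s(e.1, e.2) = s(e'.1, e'.2) → e = e' := by
    intro e he e' he' h
    rcases Sym2.eq_iff.1 h with h | h
    · exact Prod.ext h.1 h.2
    · have h1 := ((hmem e).1 he).2
      have h2 := ((hmem e').1 he').2
      rw [h.1, h.2] at h1
      exact absurd h1 (lt_asymm h2)
  have hloop : ∀ e ∈ E, e.1 ≠ e.2 := fun e he => ((hmem e).1 he).1.ne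
  have hs : ∀ e ∈ E, (e.2, e.1) ∉ E := fun e he he' =>
    lt_asymm ((hmem e).1 he).2 ((hmem _).1 he').2
  have hcard : E.card ≤ 3 * k + 1 := by
    refine le_trans ?_ hm
    apply Finset.card_le_card_of_injOn (fun e => s(e.1, e.2))
    · intro e he
      have := ((hmem e).1 he).1
      simpa using this
    · intro e he e' he' h
      exact hinj e he e' he' h
  have hdeg : ∀ v, jn E Finset.univ v ≤ 2 * k + 1 := by
    intro v
    refine le_trans ?_ (hd v)
    unfold jn
    rw [← G.card_neighborFinset_eq_degree]
    apply Finset.card_le_card_of_injOn (fun e => if e.1 = v then e.2 else e.1)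
    · intro e he
      simp only [Finset.coe_filter, Finset.mem_univ, and_true, Set.mem_ofPred_eq] at he
      have h1 := ((hmem e).1 he.1).1
      simp only [Finset.mem_coe, SimpleGraph.mem_neighborFinset]
      split_ifs with h
      · exact h ▸ h1
      · have := he.2.resolve_left h
        exact this ▸ h1.symm
    · intro e he e' he' h
      simp only [Finset.coe_filter, Finset.mem_univ, and_true, Set.mem_ofPred_eq] at he he'
      apply hinj e he.1 e' he'.1
      simp only at h
      split_ifs at h with h1 h2 h2
      · rw [h1, h2, h]
      · rw [h1, h, he'.2.resolve_left h2, Sym2.eq_swap]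
      · rw [h2, ← h, he.2.resolve_left h1, Sym2.eq_swap]
      · rw [he.2.resolve_left h1, h, he'.2.resolve_left h2]
  obtain ⟨w, g, hw, hg, hgi⟩ := pad_label E hloop hs k hk hcard hdeg
  have hor : ∀ u v, G.Adj u v → ∃ e ∈ E, s(u, v) = s(e.1, e.2) ∧ w u + w v = w e.1 + w e.2 := by
    intro u v h
    rcases lt_trichotomy (φ u) (φ v) with h1 | h1 | h1
    · exact ⟨(u, v), (hmem _).2 ⟨h, h1⟩, rfl, rfl⟩
    · exact absurd (φ.injective h1) h.ne
    · exact ⟨(v, u), (hmem _).2 ⟨h.symm, h1⟩, Sym2.eq_swap, add_comm _ _⟩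
  let we : Sym2 V → ℕ := fun x => if h : ∃ e ∈ E, s(e.1, e.2) = x then g h.choose + 1 else 1
  have hwe : ∀ e ∈ E, we s(e.1, e.2) = g e + 1 := by
    intro e he
    have h : ∃ e' ∈ E, s(e'.1, e'.2) = s(e.1, e.2) := ⟨e, he, rfl⟩
    have h2 : h.choose = e := hinj _ h.choose_spec.1 e he h.choose_spec.2
    simp only [we]
    rw [dif_pos h, h2]
  refine ⟨fun v => w v + 1, we, ?_, ?_, ?_⟩
  · intro v
    have := hw v
    simp only
    omega
  · intro x hx
    induction x using Sym2.ind with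
    | _ u v =>
      obtain ⟨e, he, h1, -⟩ := hor u v hx
      rw [h1, hwe e he]
      have := hg e he
      omega
  · intro u v u' v' h h' hne heq
    obtain ⟨e, he, h1, h2⟩ := hor u v h
    obtain ⟨e', he', h1', h2'⟩ := hor u' v' h'
    apply hne
    rw [h1, h1'] at heq ⊢
    rw [hwe e he, hwe e' he'] at heq
    have : e = e' := by
      apply hgi he he'
      simp only at heq ⊢
      omega
    rw [this]

lemma lower (G : SimpleGraph V) [DecidableRel G.Adj] (s : ℕ) (wv : V → ℕ) (we : Sym2 V → ℕ)
    (h : IsEdgeIrregularTotalWeighting G s wv we) :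
    G.edgeFinset.card ≤ 3 * s + 1 - 3 ∧ ∀ v, G.degree v ≤ 2 * s + 1 - 2 := by
  obtain ⟨hv, he, hd⟩ := h
  constructor
  · rw [← Nat.card_Icc]
    let T : Sym2 V → ℕ := fun e => we e + Sym2.lift ⟨fun u v => wv u + wv v, fun u v => add_comm _ _⟩ e
    have hT : ∀ u v, T s(u, v) = we s(u, v) + wv u + wv v := by
      intro u v
      simp only [T, Sym2.lift_mk]
      omega
    apply Finset.card_le_card_of_injOn T
    · intro x hx
      induction x using Sym2.ind with
      | _ u v =>
        have hx' : s(u, v) ∈ G.edgeSet := by simpa using hx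
        have a1 := he _ hx'
        have a2 := hv u
        have a3 := hv v
        rw [Finset.coe_Icc, Set.mem_Icc, hT]
        omega
    · intro x hx y hy hxy
      induction x using Sym2.ind with
      | _ u v =>
        induction y using Sym2.ind with
        | _ u' v' =>
          by_contra hne
          rw [hT, hT] at hxy
          exact hd u v u' v' (by simpa using hx) (by simpa using hy) hne hxy
  · intro v
    rw [← G.card_neighborFinset_eq_degree, ← Nat.card_Icc]
    apply Finset.card_le_card_of_injOn (fun u => we s(v, u) + wv u)
    · intro u hu
      have hu' : G.Adj v u := by simpa using hu
      have a1 := he s(v, u) hu'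
      have a2 := hv u
      rw [Finset.coe_Icc, Set.mem_Icc]
      simp only
      omega
    · intro u hu u' hu' huu
      have hu1 : G.Adj v u := by simpa using hu
      have hu2 : G.Adj v u' := by simpa using hu'
      by_contra hne
      refine hd v u v u' hu1 hu2 ?_ ?_
      · intro h
        exact hne (Sym2.congr_right.1 h)
      · simp only at huu
        omega

end TES

/-- If `G` is a finite simple graph with `m ≥ 7·10^10` edges and maximum
degree `Δ`, then `tes(G) = max{⌈(m+2)/3⌉, ⌈(Δ+1)/2⌉}`. -/
theorem tes_eq_max_of_large {V : Type*} [Fintype V] [DecidableEq V]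
    (G : SimpleGraph V) [DecidableRel G.Adj]
    (m : ℕ) (hm : m = G.edgeSet.ncard) (hlarge : 7 * 10 ^ 10 ≤ m) :
    (tes G : ℤ) = max ⌈((m : ℚ) + 2) / 3⌉ ⌈((G.maxDegree : ℚ) + 1) / 2⌉ := by
  classical
  have hm' : m = G.edgeFinset.card := by
    rw [hm, Set.ncard_eq_toFinset_card', SimpleGraph.edgeFinset]
  have hne : Nonempty V := by
    by_contra hcon
    rw [not_nonempty_iff] at hcon
    have : G.edgeFinset.card = 0 := by
      rw [Finset.card_eq_zero, Finset.eq_empty_iff_forall_notMem]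
      intro x
      induction x using Sym2.ind with
      | _ u v => exact (hcon.false u).elim
    omega
  obtain ⟨v0, hv0⟩ := G.exists_maximal_degree_vertex
  have c1 : ⌈((m : ℚ) + 2) / 3⌉ = (((m + 4) / 3 : ℕ) : ℤ) := by
    rw [Int.ceil_eq_iff]
    have h1 : m + 2 ≤ 3 * ((m + 4) / 3) := by omega
    have h2 : 3 * ((m + 4) / 3) ≤ m + 4 := by omega
    have h1' : ((m : ℚ) + 2) ≤ 3 * (((m + 4) / 3 : ℕ) : ℚ) := by exact_mod_cast h1
    have h2' : 3 * (((m + 4) / 3 : ℕ) : ℚ) ≤ (m : ℚ) + 4 := by exact_mod_cast h2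
    rw [Int.cast_natCast]
    constructor <;> linarith
  have c2 : ⌈((G.maxDegree : ℚ) + 1) / 2⌉ = (((G.maxDegree + 2) / 2 : ℕ) : ℤ) := by
    generalize G.maxDegree = d
    rw [Int.ceil_eq_iff]
    have h1 : d + 1 ≤ 2 * ((d + 2) / 2) := by omega
    have h2 : 2 * ((d + 2) / 2) ≤ d + 2 := by omega
    have h1' : ((d : ℚ) + 1) ≤ 2 * (((d + 2) / 2 : ℕ) : ℚ) := by exact_mod_cast h1
    have h2' : 2 * (((d + 2) / 2 : ℕ) : ℚ) ≤ (d : ℚ) + 2 := by exact_mod_cast h2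
    rw [Int.cast_natCast]
    constructor <;> linarith
  rw [c1, c2, ← Nat.cast_max]
  congr 1
  obtain ⟨k, hk⟩ : ∃ k, max ((m + 4) / 3) ((G.maxDegree + 2) / 2) = k + 1 :=
    ⟨max ((m + 4) / 3) ((G.maxDegree + 2) / 2) - 1, by omega⟩
  have hup := TES.upper G k (by omega) (by omega) (fun v => by
    have := G.degree_le_maxDegree v
    omega)
  rw [← hk] at hup
  apply le_antisymm
  · exact Nat.sInf_le hup
  · refine le_csInf ⟨_, hup⟩ ?_
    rintro s ⟨wv, we, h⟩
    obtain ⟨l1, l2⟩ := TES.lower G s wv we h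
    have l3 := l2 v0
    rw [← hv0] at l3
    omega
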